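/- arXiv:2509.15914 — 3 statements merged into one kernel-verified Lean document; each statement's English description precedes it below -/
import Mathlib

section
/- Let E be a finite-dimensional real inner product space, A = (a_s)_{s∈S} a finite acyclic family of vectors of E, 𝓑 an oriented building set for A, and 𝓕 := {B ∈ 𝓑 : B is a face of A}. Then the inclusion-maximal elements of 𝓑 and of 𝓕 coincide: 𝓒(𝓑) = 𝓒(𝓕). Moreover, for every N with 𝓒(𝓑) ⊆ N ⊆ 𝓑, the following are equivalent: (a) N is a nested set on 𝓑 and ⋃N' is a face of A for every subfamily N' ⊆ N; (b) N ⊆ 𝓕 and for every k ≥ 2 and pairwise inclusion-incomparable B₁, …, B_k ∈ N∖𝓒(𝓑), the smallest face cl_A(B₁ ∪ ⋯ ∪ B_k) of A containing B₁ ∪ ⋯ ∪ B_k does not belong to 𝓕. In other words, the facial nested complex of 𝓕 coincides with the acyclic nested complex of (𝓑, A). -/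
/-- `F` is a face of the family of vectors `A`: some linear functional vanishes on
`{A s : s ∈ F}` and is positive on the remaining vectors of the family. -/
def IsFaceOf {S E : Type*} [AddCommGroup E] [Module ℝ E] (A : S → E) (F : Set S) : Prop :=
  ∃ f : E →ₗ[ℝ] ℝ, (∀ s ∈ F, f (A s) = 0) ∧ ∀ s ∉ F, 0 < f (A s)

/-- `c` is the support of a support-minimal nonzero linear dependence of the family `A`. -/
def IsCircuitSupport {S E : Type*} [Fintype S] [AddCommGroup E] [Module ℝ E]
    (A : S → E) (c : Set S) : Prop :=
  ∃ δ : S → ℝ, δ ≠ 0 ∧ ∑ s, δ s • A s = 0 ∧ c = {s | δ s ≠ 0} ∧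
    ∀ δ' : S → ℝ, δ' ≠ 0 → ∑ s, δ' s • A s = 0 →
      {s | δ' s ≠ 0} ⊆ {s | δ s ≠ 0} → {s | δ' s ≠ 0} = {s | δ s ≠ 0}

/-- A (boolean) building set on the ground set `S`: a collection of nonempty subsets of `S`
containing all singletons, such that any two members with nonempty intersection have their
union in the collection. -/
def IsBoolBuilding {S : Type*} (C : Set (Set S)) : Prop :=
  (∀ c ∈ C, c.Nonempty) ∧ (∀ s : S, {s} ∈ C) ∧
    ∀ c ∈ C, ∀ d ∈ C, (c ∩ d).Nonempty → c ∪ d ∈ C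

/-- An oriented building set for the family `A`: a building set on `S` containing all the
circuit supports of `A`. -/
def IsOrientedBuilding {S E : Type*} [Fintype S] [AddCommGroup E] [Module ℝ E]
    (A : S → E) (B : Set (Set S)) : Prop :=
  IsBoolBuilding B ∧ ∀ c : Set S, IsCircuitSupport A c → c ∈ B

/-- The smallest face of `A` containing `X`: the intersection of all faces of `A`
containing `X`. -/
def faceClosure {S E : Type*} [AddCommGroup E] [Module ℝ E] (A : S → E) (X : Set S) : Set S :=
  ⋂₀ {F | IsFaceOf A F ∧ X ⊆ F}

/-- The connected components (inclusion-maximal members) of a family of subsets of `S`. -/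
def boolConn {S : Type*} (C : Set (Set S)) : Set (Set S) :=
  {c | c ∈ C ∧ ∀ d ∈ C, c ⊆ d → c = d}

/-- A (boolean) nested set on a building set `C` on `S`: a subset of `C` containing the
connected components of `C`, whose members are pairwise nested or disjoint, and such that the
union of `k ≥ 2` pairwise disjoint members never belongs to `C`. -/
def IsBoolNested {S : Type*} (C N : Set (Set S)) : Prop :=
  N ⊆ C ∧ boolConn C ⊆ N ∧
    (∀ c ∈ N, ∀ d ∈ N, c ⊆ d ∨ d ⊆ c ∨ c ∩ d = ∅) ∧
    ∀ A : Finset (Set S), ↑A ⊆ N → 2 ≤ A.card →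
      (↑A : Set (Set S)).Pairwise (fun c d => c ∩ d = ∅) → A.sup id ∉ C

section FaceClosure

variable {S E : Type*} [AddCommGroup E] [Module ℝ E] {A : S → E}

theorem isFaceOf_univ : IsFaceOf A Set.univ :=
  ⟨0, fun _ _ => rfl, fun s hs => absurd (Set.mem_univ s) hs⟩

theorem subset_faceClosure (X : Set S) : X ⊆ faceClosure A X :=
  Set.subset_sInter fun _ h => h.2

theorem faceClosure_subset {X F : Set S} (hF : IsFaceOf A F) (h : X ⊆ F) :
    faceClosure A X ⊆ F :=
  Set.sInter_subset_of_mem ⟨hF, h⟩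

theorem faceClosure_eq_self {F : Set S} (hF : IsFaceOf A F) : faceClosure A F = F :=
  (faceClosure_subset hF subset_rfl).antisymm (subset_faceClosure F)

end FaceClosure

section Components

variable {S : Type*} {B : Set (Set S)} {F K b : Set S}

/-- A member of a building set contained in `F` is contained in or disjoint from each
connected component of the restriction to `F`. -/
theorem IsBoolBuilding.subset_or_inter_eq_empty (hB : IsBoolBuilding B)
    (hK : K ∈ boolConn {b | b ∈ B ∧ b ⊆ F}) (hb : b ∈ B) (hbF : b ⊆ F) :
    b ⊆ K ∨ b ∩ K = ∅ := by
  rcases Set.eq_empty_or_nonempty (b ∩ K) with h | h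
  · exact Or.inr h
  · left
    have := hK.2 (b ∪ K) ⟨hB.2.2 b hb K hK.1.1 h, Set.union_subset hbF hK.1.2⟩
      Set.subset_union_right
    rw [this]
    exact Set.subset_union_left

theorem exists_mem_boolConn_superset [Finite S] {C : Set (Set S)} (hb : b ∈ C) :
    ∃ K ∈ boolConn C, b ⊆ K := by
  obtain ⟨K, hbK, hK⟩ := C.toFinite.exists_le_maximal hb
  exact ⟨K, ⟨hK.prop, fun d hd hKd => hKd.antisymm (hK.le_of_ge hd hKd)⟩, hbK⟩

theorem sUnion_boolConn [Finite S] (C : Set (Set S)) : ⋃₀ boolConn C = ⋃₀ C := by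
  refine (Set.sUnion_subset_sUnion fun c hc => hc.1).antisymm ?_
  rintro s ⟨b, hb, hsb⟩
  obtain ⟨K, hK, hbK⟩ := exists_mem_boolConn_superset hb
  exact ⟨K, hK, hbK hsb⟩

end Components

section Circuits

variable {S E : Type*} [Fintype S] [AddCommGroup E] [Module ℝ E] {A : S → E}

/-- Below every nonzero linear dependence there is one whose support is a circuit support. -/
theorem exists_isCircuitSupport_subset {δ : S → ℝ} (h0 : δ ≠ 0) (hδ : ∑ s, δ s • A s = 0) :
    ∃ ε : S → ℝ, ε ≠ 0 ∧ ∑ s, ε s • A s = 0 ∧ IsCircuitSupport A {s | ε s ≠ 0} ∧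
      {s | ε s ≠ 0} ⊆ {s | δ s ≠ 0} := by
  let supports : Set (Set S) :=
    {c | ∃ ε : S → ℝ, ε ≠ 0 ∧ ∑ s, ε s • A s = 0 ∧ c = {s | ε s ≠ 0}}
  obtain ⟨c, hcδ, hc⟩ := supports.toFinite.exists_le_minimal
    (show {s | δ s ≠ 0} ∈ supports from ⟨δ, h0, hδ, rfl⟩)
  obtain ⟨ε, hε0, hε, rfl⟩ := hc.prop
  refine ⟨ε, hε0, hε, ⟨ε, hε0, hε, rfl, fun δ' h0' hδ' hsub => ?_⟩, hcδ⟩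
  exact hsub.antisymm (hc.le_of_le ⟨δ', h0', hδ', rfl⟩ hsub)

/-- If each circuit support inside `F` is contained in or disjoint from `K`, then restricting
to `K` a linear dependence supported in `F` yields a linear dependence. -/
theorem sum_indicator_smul_eq_zero {F K : Set S}
    (hK : ∀ c, IsCircuitSupport A c → c ⊆ F → c ⊆ K ∨ c ∩ K = ∅)
    (δ : S → ℝ) (hδ : ∑ s, δ s • A s = 0) (hF : {s | δ s ≠ 0} ⊆ F) :
    ∑ s, K.indicator δ s • A s = 0 := by
  classical
  induction hn : {s | δ s ≠ 0}.ncard using Nat.strong_induction_on generalizing δ with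
  | _ n ih =>
    by_cases h0 : δ = 0
    · simp [h0]
    obtain ⟨ε, hε0, hε, hcirc, hsub⟩ := exists_isCircuitSupport_subset h0 hδ
    obtain ⟨t, ht⟩ := Function.ne_iff.1 hε0
    have ht' : ε t ≠ 0 := ht
    have hεK : ∑ s, K.indicator ε s • A s = 0 := by
      rcases hK _ hcirc (hsub.trans hF) with h | h
      · rw [Set.indicator_eq_self.2 h, hε]
      · have : K.indicator ε = 0 := by
          exact Set.indicator_eq_zero'.2 (Set.disjoint_iff_inter_eq_empty.2 h)
        simp [this]
    have hsub' : {s | (δ - (δ t / ε t) • ε) s ≠ 0} ⊆ {s | δ s ≠ 0} := fun s hs hs0 => by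
      have : ε s = 0 := by
        by_contra hne
        exact hsub hne hs0
      exact hs (by simp [hs0, this])
    have hlt : {s | (δ - (δ t / ε t) • ε) s ≠ 0}.ncard < n := by
      rw [← hn]
      refine Set.ncard_lt_ncard ⟨hsub', fun h => ?_⟩
      exact h (hsub ht') (by simp [ht'])
    have hdep : ∑ s, (δ - (δ t / ε t) • ε) s • A s = 0 := by
      simp [sub_smul, mul_smul, Finset.sum_sub_distrib, ← Finset.smul_sum, hδ, hε]
    have hrest := ih _ hlt _ hdep (hsub'.trans hF) rfl
    have hind : ∀ s, K.indicator δ s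
        = K.indicator (δ - (δ t / ε t) • ε) s + (δ t / ε t) * K.indicator ε s := fun s => by
      by_cases hs : s ∈ K <;> simp [hs]
    simp only [hind, add_smul, mul_smul, Finset.sum_add_distrib, hrest, ← Finset.smul_sum, hεK]
    simp

theorem IsOrientedBuilding.sum_indicator_smul_eq_zero {B : Set (Set S)}
    (hB : IsOrientedBuilding A B) {F K : Set S} (hK : K ∈ boolConn {b | b ∈ B ∧ b ⊆ F}) {δ : S → ℝ}
    (hδ : ∑ s, δ s • A s = 0) (hF : ∀ s ∉ F, δ s = 0) :
    ∑ s, K.indicator δ s • A s = 0 :=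
  _root_.sum_indicator_smul_eq_zero
    (fun c hc hcF => hB.1.subset_or_inter_eq_empty hK (hB.2 c hc) hcF) δ hδ
    fun s hs => by_contra fun h => hs (hF s h)

end Circuits

section Faces

variable {S E : Type*} [Fintype S] [NormedAddCommGroup E] [InnerProductSpace ℝ E]
  {A : S → E}

/-- A set `F` satisfying the dual condition of `isFaceOf_iff` is a face. -/
theorem isFaceOf_of_forall_dependence {F : Set S}
    (h : ∀ δ : S → ℝ, ∑ s, δ s • A s = 0 → (∀ s ∉ F, 0 ≤ δ s) → ∀ s ∉ F, δ s = 0) :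
    IsFaceOf A F := by
  classical
  let L : (S → ℝ) →ₗ[ℝ] E := Fintype.linearCombination ℝ A
  have hL : ∀ w, L w = ∑ s, w s • A s := fun w => Fintype.linearCombination_apply ℝ A w
  have hsingle : ∀ s, L (Pi.single s 1) = A s := fun s => by
    simp [L, Fintype.linearCombination_apply_single]
  let Q : Submodule ℝ (S → ℝ) :=
    { carrier := {w | ∀ s ∉ F, w s = 0}
      add_mem' := fun ha hb s hs => by simp [ha s hs, hb s hs]
      zero_mem' := fun s _ => rfl
      smul_mem' := fun c x hx s hs => by simp [hx s hs] }
  let R : Submodule ℝ (S → ℝ) :=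
    { carrier := {w | ∀ s ∈ F, w s = 0}
      add_mem' := fun ha hb s hs => by simp [ha s hs, hb s hs]
      zero_mem' := fun s _ => rfl
      smul_mem' := fun c x hx s hs => by simp [hx s hs] }
  have hPcompact : IsCompact (L '' (stdSimplex ℝ S ∩ R)) :=
    ((isCompact_stdSimplex ℝ S).inter_right R.closed_of_finiteDimensional).image
      L.continuous_of_finiteDimensional
  have hPconvex : Convex ℝ (L '' (stdSimplex ℝ S ∩ R)) :=
    ((convex_stdSimplex ℝ S).inter R.convex).linear_image L
  have hdisj : Disjoint (L '' (stdSimplex ℝ S ∩ R)) (Q.map L : Set E) := by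
    rw [Set.disjoint_left]
    rintro _ ⟨w, ⟨hw, hwR⟩, rfl⟩ ⟨q, hq, hqw⟩
    have hdep : ∑ s, (w - q) s • A s = 0 := by
      rw [← hL, map_sub, hqw, sub_self]
    have hout : ∀ s ∉ F, (w - q) s = w s := fun s hs => by
      have : q s = 0 := hq s hs
      simp [this]
    have hzero := h (w - q) hdep fun s hs => by rw [hout s hs]; exact hw.1 s
    have hw0 : ∀ s, w s = 0 := fun s => by
      by_cases hs : s ∈ F
      · exact hwR s hs
      · rw [← hout s hs]; exact hzero s hs
    have h1 := hw.2
    simp [hw0] at h1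
  obtain ⟨f, u, v, hfu, huv, hfv⟩ := geometric_hahn_banach_compact_closed hPconvex hPcompact
    (Q.map L).convex (Q.map L).closed_of_finiteDimensional hdisj
  have hv : v < 0 := by simpa using hfv 0 (Q.map L).zero_mem
  have hQ : ∀ x ∈ Q.map L, f x = 0 := fun x hx => by
    by_contra hne
    have := hfv ((v / f x) • x) ((Q.map L).smul_mem _ hx)
    simp [hne] at this
  refine ⟨-f.toLinearMap, fun s hs => ?_, fun s hs => ?_⟩
  · have hmem : A s ∈ Q.map L := by
      refine ⟨Pi.single s 1, fun t ht => ?_, hsingle s⟩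
      exact Pi.single_eq_of_ne (ne_of_mem_of_not_mem hs ht).symm 1
    simpa using hQ _ hmem
  · have hmem : A s ∈ L '' (stdSimplex ℝ S ∩ R) := by
      refine ⟨Pi.single s 1, ⟨single_mem_stdSimplex ℝ s, fun t ht => ?_⟩, hsingle s⟩
      exact Pi.single_eq_of_ne (ne_of_mem_of_not_mem ht hs) 1
    have := hfu _ hmem
    simp only [LinearMap.neg_apply, ContinuousLinearMap.coe_coe]
    linarith

/-- Dual characterization of faces: a linear dependence that is nonnegative outside a face
vanishes outside it. -/
theorem isFaceOf_iff {F : Set S} :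
    IsFaceOf A F ↔
      ∀ δ : S → ℝ, ∑ s, δ s • A s = 0 → (∀ s ∉ F, 0 ≤ δ s) → ∀ s ∉ F, δ s = 0 := by
  refine ⟨?_, isFaceOf_of_forall_dependence⟩
  rintro ⟨f, hf0, hfpos⟩ δ hδ hnonneg s hs
  have hsum : ∑ s, δ s * f (A s) = 0 := by
    simpa using congrArg f hδ
  have hterm : ∀ t ∈ Finset.univ, 0 ≤ δ t * f (A t) := fun t _ => by
    by_cases ht : t ∈ F
    · simp [hf0 t ht]
    · exact mul_nonneg (hnonneg t ht) (hfpos t ht).le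
  have := (Finset.sum_eq_zero_iff_of_nonneg hterm).1 hsum s (Finset.mem_univ s)
  exact (mul_eq_zero.1 this).resolve_right (hfpos s hs).ne'

theorem isFaceOf_faceClosure (X : Set S) : IsFaceOf A (faceClosure A X) := by
  refine isFaceOf_iff.2 fun δ hδ hnonneg s hs => ?_
  obtain ⟨F, ⟨hF, hXF⟩, hsF⟩ : ∃ F, (IsFaceOf A F ∧ X ⊆ F) ∧ s ∉ F := by
    simpa [faceClosure, and_assoc] using hs
  exact isFaceOf_iff.1 hF δ hδ
    (fun t ht => hnonneg t fun h => ht (h F ⟨hF, hXF⟩)) s hsF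

end Faces

section OrientedBuilding

variable {S E : Type*} [Fintype S] [NormedAddCommGroup E] [InnerProductSpace ℝ E]
  {A : S → E} {B : Set (Set S)}

/-- The connected components of the restriction of an oriented building set to a face are
faces. -/
theorem IsOrientedBuilding.isFaceOf_component (hB : IsOrientedBuilding A B)
    (hacyc : IsFaceOf A (∅ : Set S)) {F K : Set S} (hF : IsFaceOf A F)
    (hK : K ∈ boolConn {b | b ∈ B ∧ b ⊆ F}) : IsFaceOf A K := by
  refine isFaceOf_iff.2 fun δ hδ hnonneg s hs => ?_
  have hδF := isFaceOf_iff.1 hF δ hδ fun t ht => hnonneg t fun h => ht (hK.1.2 h)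
  have hδK := hB.sum_indicator_smul_eq_zero hK hδ hδF
  have hdep : ∑ t, (δ t - K.indicator δ t) • A t = 0 := by
    simp [sub_smul, Finset.sum_sub_distrib, hδ, hδK]
  have := isFaceOf_iff.1 hacyc _ hdep (fun t _ => by
    by_cases ht : t ∈ K
    · simp [ht]
    · simpa [ht] using hnonneg t ht) s (Set.notMem_empty s)
  simpa [hs] using this

/-- A subset of a face `F` that meets every connected component of the restriction to `F` in a
face is itself a face. -/
theorem IsOrientedBuilding.isFaceOf_of_forall_component (hB : IsOrientedBuilding A B)
    {F G : Set S} (hF : IsFaceOf A F) (hGF : G ⊆ F)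
    (hG : ∀ K ∈ boolConn {b | b ∈ B ∧ b ⊆ F}, IsFaceOf A (G ∩ K)) : IsFaceOf A G := by
  refine isFaceOf_iff.2 fun δ hδ hnonneg s hs => ?_
  have hδF := isFaceOf_iff.1 hF δ hδ fun t ht => hnonneg t fun h => ht (hGF h)
  by_cases hsF : s ∈ F
  · obtain ⟨K, hK, hsK⟩ := exists_mem_boolConn_superset
      (show {s} ∈ {b | b ∈ B ∧ b ⊆ F} from ⟨hB.1.2.1 s, Set.singleton_subset_iff.2 hsF⟩)
    have hsK : s ∈ K := hsK rfl
    have := isFaceOf_iff.1 (hG K hK) _ (hB.sum_indicator_smul_eq_zero hK hδ hδF) (fun t ht => by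
      by_cases htK : t ∈ K
      · simpa [htK] using hnonneg t fun h => ht ⟨h, htK⟩
      · simp [htK]) s fun h => hs h.1
    simpa [hsK] using this
  · exact hδF s hsF

theorem IsOrientedBuilding.faceClosure_mem (hB : IsOrientedBuilding A B)
    (hacyc : IsFaceOf A (∅ : Set S)) {X : Set S} (hX : X ∈ B) : faceClosure A X ∈ B := by
  obtain ⟨K, hK, hXK⟩ := exists_mem_boolConn_superset
    (show X ∈ {b | b ∈ B ∧ b ⊆ faceClosure A X} from ⟨hX, subset_faceClosure X⟩)
  have hKface := hB.isFaceOf_component hacyc (isFaceOf_faceClosure X) hK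
  rw [(faceClosure_subset hKface hXK).antisymm hK.1.2]
  exact hK.1.1

theorem IsOrientedBuilding.isFaceOf_of_mem_boolConn (hB : IsOrientedBuilding A B)
    (hacyc : IsFaceOf A (∅ : Set S)) {K : Set S} (hK : K ∈ boolConn B) : IsFaceOf A K :=
  hB.isFaceOf_component hacyc isFaceOf_univ (by simpa using hK)

theorem IsOrientedBuilding.boolConn_facial (hB : IsOrientedBuilding A B)
    (hacyc : IsFaceOf A (∅ : Set S)) :
    boolConn B = boolConn {b | b ∈ B ∧ IsFaceOf A b} := by
  refine Set.Subset.antisymm (fun c hc => ?_) fun c hc => ?_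
  · exact ⟨⟨hc.1, hB.isFaceOf_of_mem_boolConn hacyc hc⟩, fun d hd => hc.2 d hd.1⟩
  · obtain ⟨K, hK, hcK⟩ := exists_mem_boolConn_superset hc.1.1
    rwa [hc.2 K ⟨hK.1, hB.isFaceOf_of_mem_boolConn hacyc hK⟩ hcK]

/-- The closure of the part of `X` in a connected component of the face spanned by `X` is that
whole component. -/
theorem IsOrientedBuilding.faceClosure_inter_component (hB : IsOrientedBuilding A B)
    (hacyc : IsFaceOf A (∅ : Set S)) {X K : Set S}
    (hK : K ∈ boolConn {b | b ∈ B ∧ b ⊆ faceClosure A X}) :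
    faceClosure A (X ∩ K) = K := by
  have hF := isFaceOf_faceClosure (A := A) X
  have hsub : faceClosure A (X ∩ K) ⊆ K :=
    faceClosure_subset (hB.isFaceOf_component hacyc hF hK) Set.inter_subset_right
  refine hsub.antisymm fun s hs => ?_
  have hG : IsFaceOf A ((faceClosure A X \ K) ∪ faceClosure A (X ∩ K)) := by
    refine hB.isFaceOf_of_forall_component hF
      (Set.union_subset Set.sdiff_subset (hsub.trans hK.1.2)) fun K' hK' => ?_
    rcases hB.1.subset_or_inter_eq_empty hK hK'.1.1 hK'.1.2 with h | h
    · obtain rfl := hK'.2 K hK.1 h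
      convert isFaceOf_faceClosure (A := A) (X ∩ K') using 1
      ext t
      have := @hsub t
      simp only [Set.mem_inter_iff, Set.mem_union, Set.mem_sdiff]
      tauto
    · convert hB.isFaceOf_component hacyc hF hK' using 1
      ext t
      have h1 := @hsub t
      have h2 : t ∈ K' → t ∈ faceClosure A X := fun ht => hK'.1.2 ht
      have h3 : ¬ (t ∈ K' ∧ t ∈ K) := fun ht => (h ▸ ht : t ∈ (∅ : Set S))
      simp only [Set.mem_inter_iff, Set.mem_union, Set.mem_sdiff]
      tauto
  have hXG : X ⊆ (faceClosure A X \ K) ∪ faceClosure A (X ∩ K) := fun t ht => by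
    by_cases htK : t ∈ K
    · exact Or.inr (subset_faceClosure _ ⟨ht, htK⟩)
    · exact Or.inl ⟨subset_faceClosure _ ht, htK⟩
  exact (faceClosure_subset hG hXG (hK.1.2 hs)).resolve_left fun h => h.2 hs

/-- If the closures of antichains of size at least two in `N ∖ boolConn B` are never facial
building blocks, then unions of subfamilies of `N` are faces. -/
theorem IsOrientedBuilding.isFaceOf_sUnion (hB : IsOrientedBuilding A B)
    (hacyc : IsFaceOf A (∅ : Set S)) {N : Set (Set S)}
    (hN : N ⊆ {b | b ∈ B ∧ IsFaceOf A b})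
    (hanti : ∀ A' : Finset (Set S), ↑A' ⊆ N \ boolConn B → 2 ≤ A'.card →
      (↑A' : Set (Set S)).Pairwise (fun c d => ¬ c ⊆ d ∧ ¬ d ⊆ c) →
      faceClosure A (A'.sup id) ∉ {b | b ∈ B ∧ IsFaceOf A b})
    {N' : Set (Set S)} (hN' : N' ⊆ N) : IsFaceOf A (⋃₀ N') := by
  classical
  have hF := isFaceOf_faceClosure (A := A) (⋃₀ N')
  refine hB.isFaceOf_of_forall_component hF (subset_faceClosure _) fun K hK => ?_
  have hcl := hB.faceClosure_inter_component hacyc hK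
  have hKface := hB.isFaceOf_component hacyc hF hK
  have hinter : ⋃₀ N' ∩ K = ⋃₀ boolConn {b | b ∈ N' ∧ b ⊆ K} := by
    rw [sUnion_boolConn]
    ext s
    constructor
    · rintro ⟨⟨b, hb, hsb⟩, hsK⟩
      refine ⟨b, ⟨hb, ?_⟩, hsb⟩
      refine (hB.1.subset_or_inter_eq_empty hK (hN (hN' hb)).1
        ((Set.subset_sUnion_of_mem hb).trans (subset_faceClosure _))).resolve_right fun h => ?_
      exact (h ▸ ⟨hsb, hsK⟩ : s ∈ (∅ : Set S))
    · rintro ⟨b, ⟨hb, hbK⟩, hsb⟩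
      exact ⟨⟨b, hb, hsb⟩, hbK hsb⟩
  set M : Set (Set S) := boolConn {b | b ∈ N' ∧ b ⊆ K}
  rcases M.subsingleton_or_nontrivial with hsing | hnontriv
  · rw [hinter]
    rcases hsing.eq_empty_or_singleton with h | ⟨b, h⟩
    · simpa [h] using hacyc
    · have hb : b ∈ M := by simp [h]
      simpa [h] using (hN (hN' hb.1.1)).2
  · exfalso
    have hpair : M.Pairwise (fun c d => ¬ c ⊆ d ∧ ¬ d ⊆ c) := fun c hc d hd hne =>
      ⟨fun h => hne (hc.2 d hd.1 h), fun h => hne (hd.2 c hc.1 h).symm⟩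
    have hsup : M.toFinite.toFinset.sup id = ⋃₀ M := by
      rw [Finset.sup_id_set_eq_sUnion, Set.Finite.coe_toFinset]
    refine hanti M.toFinite.toFinset (fun b hb => ?_) ?_ (by simpa using hpair) ?_
    · have hb : b ∈ M := by simpa using hb
      refine ⟨hN' hb.1.1, fun hconn => ?_⟩
      obtain ⟨c, hc, hcb⟩ := hnontriv.exists_ne b
      have hbK := hconn.2 K hK.1.1 hb.1.2
      exact (hpair hc hb hcb).1 (hbK ▸ hc.1.2)
    · rw [← Set.ncard_eq_toFinset_card M]
      exact (Set.one_lt_ncard M.toFinite).2 hnontriv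
    · rw [hsup, ← hinter, hcl]
      exact ⟨hK.1.1, hKface⟩

theorem IsOrientedBuilding.isBoolNested (hB : IsOrientedBuilding A B)
    (hacyc : IsFaceOf A (∅ : Set S)) {N : Set (Set S)} (hconn : boolConn B ⊆ N) (hNB : N ⊆ B)
    (hanti : ∀ A' : Finset (Set S), ↑A' ⊆ N \ boolConn B → 2 ≤ A'.card →
      (↑A' : Set (Set S)).Pairwise (fun c d => ¬ c ⊆ d ∧ ¬ d ⊆ c) →
      faceClosure A (A'.sup id) ∉ {b | b ∈ B ∧ IsFaceOf A b}) : IsBoolNested B N := by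
  classical
  have hanti' : ∀ A' : Finset (Set S), ↑A' ⊆ N → 2 ≤ A'.card →
      (↑A' : Set (Set S)).Pairwise (fun c d => ¬ c ⊆ d ∧ ¬ d ⊆ c) → A'.sup id ∉ B := by
    intro A' hA' hcard hpair hmem
    refine hanti A' (fun b hb => ⟨hA' hb, fun hbconn => ?_⟩) hcard hpair
      ⟨hB.faceClosure_mem hacyc hmem, isFaceOf_faceClosure _⟩
    obtain ⟨c, hc, hcb⟩ := Finset.exists_mem_ne hcard b
    have hbsup := hbconn.2 _ hmem (Finset.le_sup (f := id) hb)
    refine (hpair hc hb hcb).1 ?_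
    rw [hbsup]
    exact Finset.le_sup (f := id) hc
  refine ⟨hNB, hconn, fun c hc d hd => ?_, fun A' hA' hcard hpair => ?_⟩
  · by_contra! h
    obtain ⟨hcd, hdc, hne⟩ := h
    have hcd' : c ≠ d := fun e => hcd e.subset
    refine hanti' {c, d} ?_ (Finset.card_pair hcd').ge ?_ ?_
    · intro b hb
      rcases Finset.mem_insert.1 (Finset.mem_coe.1 hb) with rfl | hb
      · exact hc
      · exact Finset.mem_singleton.1 hb ▸ hd
    · rw [Finset.coe_pair]
      exact Set.pairwise_pair.2 fun _ => ⟨⟨hcd, hdc⟩, ⟨hdc, hcd⟩⟩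
    · simpa using hB.1.2.2 c (hNB hc) d (hNB hd) hne
  · refine hanti' A' hA' hcard fun c hc d hd hne => ?_
    have hdisj : c ∩ d = ∅ := hpair hc hd hne
    refine ⟨fun h => ?_, fun h => ?_⟩
    · rw [Set.inter_eq_left.2 h] at hdisj
      exact (hB.1.1 c (hNB (hA' hc))).ne_empty hdisj
    · rw [Set.inter_eq_right.2 h] at hdisj
      exact (hB.1.1 d (hNB (hA' hd))).ne_empty hdisj

end OrientedBuilding

/-- **Facial nested complexes coincide with acyclic nested complexes.** Let `A` be a finite
acyclic family of vectors of a finite-dimensional real inner product space, `B` an oriented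
building set for `A` and `𝓕 = {b ∈ B : b is a face of A}` its facial part.  Then the
inclusion-maximal elements of `B` and of `𝓕` coincide, and for every `N` with
`boolConn B ⊆ N ⊆ B`, `N` is a nested set on `B` all of whose subfamilies have a face of `A`
as union if and only if `N ⊆ 𝓕` and for all `k ≥ 2` pairwise inclusion-incomparable members
`b₁, …, b_k` of `N ∖ boolConn B`, the smallest face of `A` containing `b₁ ∪ ⋯ ∪ b_k` does not
belong to `𝓕`. -/
theorem facialNested_eq_acyclicNested {S E : Type*} [NormedAddCommGroup E]
    [InnerProductSpace ℝ E] [FiniteDimensional ℝ E] [Fintype S]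
    (A : S → E) (hacyc : IsFaceOf A (∅ : Set S))
    (B : Set (Set S)) (hB : IsOrientedBuilding A B) :
    boolConn B = boolConn {b | b ∈ B ∧ IsFaceOf A b} ∧
    ∀ N : Set (Set S), boolConn B ⊆ N → N ⊆ B →
      ((IsBoolNested B N ∧ ∀ N' ⊆ N, IsFaceOf A (⋃₀ N')) ↔
        (N ⊆ {b | b ∈ B ∧ IsFaceOf A b} ∧
          ∀ A' : Finset (Set S), ↑A' ⊆ N \ boolConn B → 2 ≤ A'.card →
            (↑A' : Set (Set S)).Pairwise (fun c d => ¬ c ⊆ d ∧ ¬ d ⊆ c) →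
            faceClosure A (A'.sup id) ∉ {b | b ∈ B ∧ IsFaceOf A b})) := by
  refine ⟨hB.boolConn_facial hacyc, fun N hconn hNB => ⟨?_, ?_⟩⟩
  · rintro ⟨hnested, hface⟩
    refine ⟨fun b hb => ⟨hNB hb, ?_⟩, fun A' hA' hcard hpair hmem => ?_⟩
    · simpa using hface {b} (Set.singleton_subset_iff.2 hb)
    · have hA'N : ↑A' ⊆ N := fun b hb => (hA' hb).1
      have hsup : IsFaceOf A (A'.sup id) := by
        rw [Finset.sup_id_set_eq_sUnion]
        exact hface _ hA'N
      rw [faceClosure_eq_self hsup] at hmem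
      refine hnested.2.2.2 A' hA'N hcard (fun c hc d hd hne => ?_) hmem.1
      have hinc := hpair hc hd hne
      exact ((hnested.2.2.1 c (hA'N hc) d (hA'N hd)).resolve_left hinc.1).resolve_left hinc.2
  · rintro ⟨hN, hanti⟩
    exact ⟨hB.isBoolNested hacyc hconn hNB hanti,
      fun N' hN' => hB.isFaceOf_sUnion hacyc hN hanti hN'⟩
end

section
/- Let E be a finite-dimensional real inner product space, A = (a_s)_{s∈S} a finite family of vectors of E, and 𝓑 an oriented building set for A. Then every nested set N on 𝓑 that is acyclic for A and is maximal under inclusion among all nested sets on 𝓑 acyclic for A satisfies |N| = dim span{a_s : s ∈ S}. Consequently, the acyclic nested complex of (𝓑, A), whose faces are the sets N∖𝓒(𝓑) for acyclic nested sets N, is pure of dimension dim span{a_s : s ∈ S} − |𝓒(𝓑)| − 1. -/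
/-! ### Linear dependences and circuits -/

/-- The support of a nonzero linear dependence contains a circuit support. -/
theorem exists_circuit_dependence {S E : Type*} [Fintype S] [AddCommGroup E] [Module ℝ E]
    (A : S → E) (δ : S → ℝ) (h0 : δ ≠ 0) (hδ : ∑ s, δ s • A s = 0) :
    ∃ γ : S → ℝ, γ ≠ 0 ∧ ∑ s, γ s • A s = 0 ∧ {s | γ s ≠ 0} ⊆ {s | δ s ≠ 0} ∧
      IsCircuitSupport A {s | γ s ≠ 0} := by
  obtain ⟨c, hcδ, hc⟩ := (Set.toFinite {c : Set S | ∃ γ : S → ℝ, γ ≠ 0 ∧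
    ∑ s, γ s • A s = 0 ∧ {s | γ s ≠ 0} = c}).exists_le_minimal (a := {s | δ s ≠ 0})
      ⟨δ, h0, hδ, rfl⟩
  obtain ⟨γ, hγ0, hγ, rfl⟩ := hc.prop
  exact ⟨γ, hγ0, hγ, hcδ, γ, hγ0, hγ, rfl, fun γ' h0' h' hsub =>
    hsub.antisymm (hc.le_of_le ⟨γ', h0', h', rfl⟩ hsub)⟩

/-- If no circuit contained in `P ∪ Q` meets both `P` and `Q`, then restricting to `P` a linear
dependence supported on `P ∪ Q` yields a linear dependence. -/
theorem sum_indicator_eq_zero_of_circuits {S E : Type*} [Fintype S] [AddCommGroup E]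
    [Module ℝ E] (A : S → E) {P Q : Set S} (hPQ : Disjoint P Q)
    (hC : ∀ c, IsCircuitSupport A c → c ⊆ P ∪ Q → c ⊆ P ∨ c ⊆ Q)
    (δ : S → ℝ) (hδ : ∑ s, δ s • A s = 0) (hsupp : {s | δ s ≠ 0} ⊆ P ∪ Q) :
    ∑ s, P.indicator δ s • A s = 0 := by
  induction hn : {s | δ s ≠ 0}.ncard using Nat.strong_induction_on generalizing δ with
  | _ n ih =>
    by_cases h0 : δ = 0
    · simp [h0]
    obtain ⟨γ, hγ0, hγ, hsub, hcirc⟩ := exists_circuit_dependence A δ h0 hδ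
    obtain ⟨s, hs⟩ := Function.ne_iff.mp hγ0
    have hs' : γ s ≠ 0 := hs
    have hγP : ∑ t, P.indicator γ t • A t = 0 := by
      rcases hC _ hcirc (hsub.trans hsupp) with h | h
      · rwa [Set.indicator_eq_self.mpr h]
      · rw [Set.indicator_eq_zero.mpr (hPQ.symm.mono_left h)]
        simp
    have hdep : ∑ t, (δ t - δ s / γ s * γ t) • A t = 0 := by
      simp only [sub_smul, mul_smul, Finset.sum_sub_distrib, ← Finset.smul_sum, hδ, hγ]
      simp
    have hsub' : {t | δ t - δ s / γ s * γ t ≠ 0} ⊆ {t | δ t ≠ 0} := by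
      intro t ht hδt
      have : γ t = 0 := by
        by_contra hne
        exact hsub hne hδt
      simp [hδt, this] at ht
    have hlt : {t | δ t - δ s / γ s * γ t ≠ 0}.ncard < n := by
      rw [← hn]
      refine Set.ncard_lt_ncard ((Set.ssubset_iff_of_subset hsub').mpr ⟨s, hsub hs', ?_⟩)
      simp [hs']
    have key := ih _ hlt (fun t => δ t - δ s / γ s * γ t) hdep (hsub'.trans hsupp) rfl
    have hind : ∀ t, P.indicator (fun t => δ t - δ s / γ s * γ t) t
        = P.indicator δ t - δ s / γ s * P.indicator γ t := by
      intro t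
      by_cases ht : t ∈ P <;> simp [ht]
    simp only [hind, sub_smul, mul_smul, Finset.sum_sub_distrib, ← Finset.smul_sum, hγP,
      smul_zero, sub_zero] at key
    exact key

/-- If no circuit contained in `P ∪ Q` meets both `P` and `Q`, then the spans of the two parts
are disjoint. -/
theorem disjoint_span_image_of_circuits {S E : Type*} [Fintype S] [AddCommGroup E]
    [Module ℝ E] (A : S → E) {P Q : Set S} (hPQ : Disjoint P Q)
    (hC : ∀ c, IsCircuitSupport A c → c ⊆ P ∪ Q → c ⊆ P ∨ c ⊆ Q) :
    Disjoint (Submodule.span ℝ (A '' P)) (Submodule.span ℝ (A '' Q)) := by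
  have hrep : ∀ (R : Set S) (x : E), x ∈ Submodule.span ℝ (A '' R) →
      ∃ p : S → ℝ, {s | p s ≠ 0} ⊆ R ∧ ∑ s, p s • A s = x := by
    intro R x hx
    obtain ⟨l, hl, rfl⟩ := (Finsupp.mem_span_image_iff_linearCombination ℝ).mp hx
    refine ⟨l, fun s hs => (Finsupp.mem_supported ℝ l).mp hl (by simpa using hs), ?_⟩
    rw [Finsupp.linearCombination_apply, Finsupp.sum_fintype _ _ (by simp)]
  rw [Submodule.disjoint_def]
  intro x hxP hxQ
  obtain ⟨p, hp, hpx⟩ := hrep P x hxP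
  obtain ⟨q, hq, hqx⟩ := hrep Q x hxQ
  have h := sum_indicator_eq_zero_of_circuits A hPQ hC (fun s => p s - q s)
    (by simp [sub_smul, Finset.sum_sub_distrib, hpx, hqx])
    (by
      intro s hs
      by_contra hn
      rw [Set.mem_union, not_or] at hn
      have hps : p s = 0 := by_contra fun h => hn.1 (hp h)
      have hqs : q s = 0 := by_contra fun h => hn.2 (hq h)
      simp [hps, hqs] at hs)
  rw [← hpx, ← h]
  refine Finset.sum_congr rfl fun s _ => ?_
  by_cases hs : s ∈ P
  · have hqs : q s = 0 := by_contra fun h => hPQ.notMem_of_mem_left hs (hq h)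
    simp [hs, hqs]
  · have hps : p s = 0 := by_contra fun h => hs (hp h)
    simp [hs, hps]

/-- If no circuit contained in `P ∪ Q` meets both `P` and `Q`, then linear functionals can be
prescribed independently on the two parts. -/
theorem exists_dual_of_circuits {S E : Type*} [Fintype S] [AddCommGroup E]
    [Module ℝ E] (A : S → E) {P Q : Set S} (hPQ : Disjoint P Q)
    (hC : ∀ c, IsCircuitSupport A c → c ⊆ P ∪ Q → c ⊆ P ∨ c ⊆ Q) (f g : E →ₗ[ℝ] ℝ) :
    ∃ h : E →ₗ[ℝ] ℝ, (∀ s ∈ P, h (A s) = f (A s)) ∧ ∀ s ∈ Q, h (A s) = g (A s) := by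
  obtain ⟨q, hQq, hq⟩ := (disjoint_span_image_of_circuits A hPQ hC).symm.exists_isCompl
  refine ⟨LinearMap.ofIsCompl hq (g.domRestrict q) (f.domRestrict _), fun s hs => ?_,
    fun s hs => ?_⟩
  · exact LinearMap.ofIsCompl_apply_right hq
      ⟨A s, Submodule.subset_span (Set.mem_image_of_mem A hs)⟩
  · exact LinearMap.ofIsCompl_apply_left hq
      ⟨A s, hQq (Submodule.subset_span (Set.mem_image_of_mem A hs))⟩

/-! ### Faces -/

/-- A subset of a face cut out within that face by a functional is itself a face. -/
theorem IsFaceOf.of_subset {S E : Type*} [Finite S] [AddCommGroup E] [Module ℝ E]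
    {A : S → E} {F X : Set S} (hF : IsFaceOf A F) (hXF : X ⊆ F) (g : E →ₗ[ℝ] ℝ)
    (hg0 : ∀ s ∈ X, g (A s) = 0) (hg : ∀ s ∈ F, s ∉ X → 0 < g (A s)) : IsFaceOf A X := by
  obtain ⟨f, hf0, hf⟩ := hF
  obtain ⟨K, hK⟩ := (Set.finite_range fun s => -g (A s) / f (A s)).bddAbove
  refine ⟨(K + 1) • f + g, fun s hs => ?_, fun s hs => ?_⟩
  · simp [hf0 s (hXF hs), hg0 s hs]
  · by_cases hsF : s ∈ F
    · simpa [hf0 s hsF] using hg s hsF hs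
    · have h1 := hK (Set.mem_range_self s)
      have h2 := hf s hsF
      rw [div_le_iff₀ h2] at h1
      simp only [LinearMap.add_apply, LinearMap.smul_apply, smul_eq_mul]
      linarith

/-! ### Building sets and nested sets -/

/-- The union of a member of a building set with members meeting it is again a member. -/
theorem IsBoolBuilding.union_sUnion_mem {S : Type*} [Finite S] {B : Set (Set S)}
    (hB : IsBoolBuilding B) {c : Set S} (hc : c ∈ B) {T : Set (Set S)} (hT : T ⊆ B)
    (hTc : ∀ d ∈ T, (d ∩ c).Nonempty) : c ∪ ⋃₀ T ∈ B := by
  induction T, T.toFinite using Set.Finite.induction_on with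
  | empty => simpa using hc
  | @insert d T _ _ ih =>
    have h := ih (fun e he => hT (Set.mem_insert_of_mem _ he))
      fun e he => hTc e (Set.mem_insert_of_mem _ he)
    have hu := hB.2.2 d (hT (Set.mem_insert _ _)) _ h
      ((hTc d (Set.mem_insert _ _)).mono
        (Set.inter_subset_inter_right _ Set.subset_union_left))
    rwa [Set.sUnion_insert, Set.union_left_comm]

/-- A subfamily of a nested set whose union lies in the building set contains its union. -/
theorem IsBoolNested.sUnion_mem {S : Type*} [Finite S] {B N : Set (Set S)}
    (hB : IsBoolBuilding B) (hN : IsBoolNested B N) {T : Set (Set S)} (hT : T ⊆ N)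
    (hTB : ⋃₀ T ∈ B) : ⋃₀ T ∈ T := by
  set M : Set (Set S) := {d | Maximal (· ∈ T) d} with hM
  have hMT : M ⊆ T := fun d hd => hd.prop
  have hmax : ∀ d ∈ T, ∃ m ∈ M, d ⊆ m := fun d hd => by
    obtain ⟨m, hdm, hm⟩ := T.toFinite.exists_le_maximal hd
    exact ⟨m, hm, hdm⟩
  have hunion : ⋃₀ M = ⋃₀ T := by
    refine (Set.sUnion_mono hMT).antisymm (Set.sUnion_subset fun d hd => ?_)
    obtain ⟨m, hm, hdm⟩ := hmax d hd
    exact hdm.trans (Set.subset_sUnion_of_mem hm)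
  have hdisj : M.Pairwise fun c d => c ∩ d = ∅ := by
    intro c hc d hd hcd
    rcases hN.2.2.1 c (hT hc.prop) d (hT hd.prop) with h | h | h
    · exact absurd (hc.eq_of_le hd.prop h) hcd
    · exact absurd (hd.eq_of_le hc.prop h).symm hcd
    · exact h
  have hsub : M.Subsingleton := by
    by_contra hns
    have hcard : 2 ≤ M.toFinite.toFinset.card := by
      rw [← Set.ncard_eq_toFinset_card M]
      have := mt (Set.ncard_le_one_iff_subsingleton (s := M)).mp hns
      omega
    refine hN.2.2.2 M.toFinite.toFinset (by simpa using hMT.trans hT) hcard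
      (by simpa using hdisj) ?_
    rw [Finset.sup_id_set_eq_sUnion, Set.Finite.coe_toFinset, hunion]
    exact hTB
  obtain ⟨x, d, hd, -⟩ := hB.1 _ hTB
  obtain ⟨m, hm, -⟩ := hmax d hd
  rw [← hunion, hsub.eq_singleton_of_mem hm, Set.sUnion_singleton]
  exact hMT hm

/-- A member of the building set covered by a subfamily of a nested set lies in one of its
members. -/
theorem IsBoolNested.exists_subset {S : Type*} [Finite S] {B N : Set (Set S)}
    (hB : IsBoolBuilding B) (hN : IsBoolNested B N) {T : Set (Set S)} (hT : T ⊆ N)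
    {c : Set S} (hc : c ∈ B) (hcT : c ⊆ ⋃₀ T) : ∃ d ∈ T, c ⊆ d := by
  set T' : Set (Set S) := {d ∈ T | (d ∩ c).Nonempty} with hT'
  have hcT' : c ⊆ ⋃₀ T' := fun x hx => by
    obtain ⟨d, hd, hxd⟩ := hcT hx
    exact ⟨d, ⟨hd, x, hxd, hx⟩, hxd⟩
  have hmem := hB.union_sUnion_mem hc (T := T') (fun d hd => hN.1 (hT hd.1)) fun d hd => hd.2
  rw [Set.union_eq_right.mpr hcT'] at hmem
  exact ⟨_, (hN.sUnion_mem hB (fun d hd => hT hd.1) hmem).1, hcT'⟩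

/-- The union of the members of `N` strictly contained in `b`. -/
def properUnion {S : Type*} (N : Set (Set S)) (b : Set S) : Set S :=
  ⋃₀ {d ∈ N | d ⊂ b}

theorem properUnion_subset {S : Type*} (N : Set (Set S)) (b : Set S) :
    properUnion N b ⊆ b :=
  Set.sUnion_subset fun _ hd => hd.2.subset

theorem subset_properUnion {S : Type*} {N : Set (Set S)} {b d : Set S} (hd : d ∈ N)
    (hdb : d ⊂ b) : d ⊆ properUnion N b :=
  Set.subset_sUnion_of_mem ⟨hd, hdb⟩

theorem IsBoolNested.exists_mem_notMem_properUnion {S : Type*} [Finite S] {B N : Set (Set S)}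
    (hB : IsBoolBuilding B) (hN : IsBoolNested B N) {b : Set S} (hb : b ∈ N) :
    ∃ s ∈ b, s ∉ properUnion N b := by
  by_contra! h
  obtain ⟨d, hd, hbd⟩ := hN.exists_subset hB (fun d hd => hd.1) (hN.1 hb) h
  exact hd.2.not_subset hbd

/-- Let `F` lie strictly between `properUnion N b` and `b`, and let `c` be a maximal member of
`B` inside `F`. Then `c` can be added to the nested set `N`. -/
theorem IsBoolNested.insert {S : Type*} [Finite S] {B N : Set (Set S)}
    (hB : IsBoolBuilding B) (hN : IsBoolNested B N) {b F c : Set S} (hb : b ∈ N)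
    (hUF : properUnion N b ⊆ F) (hFb : F ⊆ b)
    (hc : Maximal (fun d => d ∈ B ∧ d ⊆ F) c) : IsBoolNested B (insert c N) := by
  have hcb : c ⊆ b := hc.prop.2.trans hFb
  have hcne := hB.1 c hc.prop.1
  have hlam : ∀ d ∈ N, c ⊆ d ∨ d ⊆ c ∨ c ∩ d = ∅ := by
    intro d hd
    rcases hN.2.2.1 b hb d hd with h | h | h
    · exact Or.inl (hcb.trans h)
    · rcases h.eq_or_ssubset with rfl | h
      · exact Or.inl hcb
      · right
        by_cases hne : (c ∩ d).Nonempty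
        · left
          have hu := hB.2.2 c hc.prop.1 d (hN.1 hd) hne
          exact Set.union_subset_iff.mp (hc.le_of_ge ⟨hu, Set.union_subset hc.prop.2
            ((subset_properUnion hd h).trans hUF)⟩ Set.subset_union_left) |>.2
        · exact Or.inr (Set.not_nonempty_iff_eq_empty.mp hne)
    · exact Or.inr (Or.inr (Set.subset_empty_iff.mp
        (h ▸ Set.inter_subset_inter_left d hcb)))
  refine ⟨Set.insert_subset hc.prop.1 hN.1, hN.2.1.trans (Set.subset_insert _ _), ?_, ?_⟩
  · rintro d (rfl | hd) e (rfl | he)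
    · exact Or.inl subset_rfl
    · exact hlam e he
    · rcases hlam d hd with h | h | h
      · exact Or.inr (Or.inl h)
      · exact Or.inl h
      · exact Or.inr (Or.inr (by rwa [Set.inter_comm]))
    · exact hN.2.2.1 d hd e he
  · intro T hT hcard hdisj hTB
    rw [Finset.sup_id_set_eq_sUnion] at hTB
    by_cases hcT : c ∈ T
    · have hTN : ∀ d ∈ T, d ≠ c → d ∈ N := fun d hd hdc => (hT hd).resolve_left hdc
      have hcd : ∀ d ∈ T, d ≠ c → ¬ c ⊆ d := fun d hd hdc hsub => by
        have : c ∩ d = ∅ := hdisj hcT hd hdc.symm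
        rw [Set.inter_eq_left.mpr hsub] at this
        exact hcne.ne_empty this
      have hcU : c ⊆ ⋃₀ (T : Set (Set S)) := Set.subset_sUnion_of_mem hcT
      by_cases hTb : ∀ d ∈ T, d ⊆ b
      · obtain ⟨d, hd, hdc⟩ := Finset.exists_mem_ne (by omega : 1 < T.card) c
        have hUle : ⋃₀ (T : Set (Set S)) ⊆ c := by
          refine hc.le_of_ge ⟨hTB, Set.sUnion_subset fun e he => ?_⟩ hcU
          by_cases hec : e = c
          · exact hec ▸ hc.prop.2
          · refine (subset_properUnion (hTN e he hec) ((hTb e he).ssubset_of_ne ?_)).trans hUF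
            rintro rfl
            exact hcd _ he hec hcb
        have hdc' : d ⊆ c := (Set.subset_sUnion_of_mem hd).trans hUle
        have : c ∩ d = ∅ := hdisj hcT hd hdc.symm
        rw [Set.inter_eq_right.mpr hdc'] at this
        exact (hB.1 d (hN.1 (hTN d hd hdc))).ne_empty this
      · push Not at hTb
        obtain ⟨d, hd, hdb⟩ := hTb
        have hu := hB.2.2 b (hN.1 hb) _ hTB (hcne.mono (Set.subset_inter hcb hcU))
        obtain ⟨e, he, hue⟩ := hN.exists_subset hB
          (T := Insert.insert b {e | e ∈ T ∧ e ≠ c})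
          (Set.insert_subset hb fun e he => hTN e he.1 he.2) hu (by
            refine Set.union_subset (Set.subset_sUnion_of_mem (Set.mem_insert _ _))
              (Set.sUnion_subset fun e he => ?_)
            by_cases hec : e = c
            · exact hec ▸ hcb.trans (Set.subset_sUnion_of_mem (Set.mem_insert _ _))
            · exact Set.subset_sUnion_of_mem (Set.mem_insert_of_mem _ ⟨he, hec⟩))
        rcases he with rfl | he
        · exact hdb (((Set.subset_sUnion_of_mem hd).trans Set.subset_union_right).trans hue)
        · exact hcd e he.1 he.2 ((hcU.trans Set.subset_union_right).trans hue)
    · refine hN.2.2.2 T (fun d hd => (hT hd).resolve_left ?_) hcard hdisj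
        (by rwa [Finset.sup_id_set_eq_sUnion])
      rintro rfl
      exact hcT hd

/-! ### Acyclic nested sets -/

/-- Let `F` be a face of `A` strictly between `properUnion N b` and `b`, and let `c` be a maximal
member of `B` inside `F`. Then adding `c` to `N` preserves acyclicity. -/
theorem isFaceOf_sUnion_insert {S E : Type*} [Fintype S] [AddCommGroup E] [Module ℝ E]
    {A : S → E} {B N : Set (Set S)} (hB : IsOrientedBuilding A B) (hN : IsBoolNested B N)
    (hA : ∀ N' ⊆ N, IsFaceOf A (⋃₀ N')) {b F c : Set S} (hb : b ∈ N) (hF : IsFaceOf A F)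
    (hUF : properUnion N b ⊆ F) (hFb : F ⊆ b)
    (hc : Maximal (fun d => d ∈ B ∧ d ⊆ F) c) :
    ∀ N' ⊆ insert c N, IsFaceOf A (⋃₀ N') := by
  intro N' hN'
  have hcb : c ⊆ b := hc.prop.2.trans hFb
  set T := N' \ {c} with hT
  have hTN : T ⊆ N := fun d hd => (hN' hd.1).resolve_left hd.2
  by_cases hcN' : c ∈ N'
  swap
  · exact hA N' fun d hd => (hN' hd).resolve_left fun h => hcN' (h ▸ hd)
  have hunion : ⋃₀ N' = c ∪ ⋃₀ T := by
    rw [← Set.sUnion_insert, hT, Set.insert_sdiff_singleton, Set.insert_eq_of_mem hcN']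
  rw [hunion]
  by_cases habs : ∃ d ∈ T, b ⊆ d
  · obtain ⟨d, hd, hbd⟩ := habs
    rw [Set.union_eq_right.mpr ((hcb.trans hbd).trans (Set.subset_sUnion_of_mem hd))]
    exact hA T hTN
  push Not at habs
  set X := c ∪ ⋃₀ T with hX
  set TY : Set (Set S) := {d ∈ T | b ∩ d = ∅} with hTY
  have hcases : ∀ d ∈ T, d ⊆ F ∨ d ∈ TY := by
    intro d hd
    rcases hN.2.2.1 b hb d (hTN hd) with h | h | h
    · exact absurd h (habs d hd)
    · exact Or.inl ((subset_properUnion (hTN hd) ⟨h, habs d hd⟩).trans hUF)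
    · exact Or.inr ⟨hd, h⟩
  have hbY : Disjoint b (⋃₀ TY) :=
    Set.disjoint_sUnion_right.mpr fun d hd => Set.disjoint_iff_inter_eq_empty.mpr hd.2
  have hXF : X ⊆ F ∪ ⋃₀ TY := by
    refine Set.union_subset (hc.prop.2.trans Set.subset_union_left)
      (Set.sUnion_subset fun d hd => ?_)
    rcases hcases d hd with h | h
    · exact h.trans Set.subset_union_left
    · exact (Set.subset_sUnion_of_mem h).trans Set.subset_union_right
  have hXb : X ∩ b ⊆ F := fun s hs =>
    (hXF hs.1).resolve_right (hbY.notMem_of_mem_left hs.2)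
  -- The part of `X` inside `b` is a face.
  have hfaceb : IsFaceOf A (X ∩ b) := by
    obtain ⟨w, hw0, hw⟩ := hA T hTN
    obtain ⟨k, hkc, hkF⟩ := exists_dual_of_circuits A (P := c) (Q := F \ c)
      Set.disjoint_sdiff_right (fun e he hesub => by
        have heF : e ⊆ F := by rwa [Set.union_sdiff_cancel hc.prop.2] at hesub
        by_cases hne : (c ∩ e).Nonempty
        · have hu := hB.1.2.2 c hc.prop.1 e (hB.2 e he) hne
          exact Or.inl (Set.subset_union_right.trans
            (hc.le_of_ge ⟨hu, Set.union_subset hc.prop.2 heF⟩ Set.subset_union_left))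
        · exact Or.inr fun s hs => ⟨heF hs, fun hsc => hne ⟨s, hsc, hs⟩⟩) 0 w
    refine hF.of_subset hXb k (fun s hs => ?_) fun s hsF hs => ?_
    · by_cases hsc : s ∈ c
      · simpa using hkc s hsc
      · rw [hkF s ⟨hXb hs, hsc⟩]
        exact hw0 s (hs.1.resolve_left hsc)
    · have hsX : s ∉ X := fun h => hs ⟨h, hFb hsF⟩
      rw [hkF s ⟨hsF, fun h => hsX (Or.inl h)⟩]
      exact hw s fun h => hsX (Or.inr h)
  have hTYN : insert b TY ⊆ N := Set.insert_subset hb fun d hd => hTN hd.1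
  have hfaceY := hA _ hTYN
  rw [Set.sUnion_insert] at hfaceY
  obtain ⟨l, hl0, hl⟩ := hfaceb
  obtain ⟨h, hhb, hhY⟩ := exists_dual_of_circuits A hbY (fun e he hesub => by
    rw [← Set.sUnion_insert] at hesub
    obtain ⟨d, hd, hed⟩ := hN.exists_subset hB.1 hTYN (hB.2 e he) hesub
    rcases hd with rfl | hd
    · exact Or.inl hed
    · exact Or.inr (hed.trans (Set.subset_sUnion_of_mem hd))) l 0
  refine hfaceY.of_subset (hXF.trans (Set.union_subset_union_left _ hFb)) h
    (fun s hs => ?_) fun s hs hsX => ?_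
  · rcases hXF hs with hsF | hsY
    · rw [hhb s (hFb hsF)]
      exact hl0 s ⟨hs, hFb hsF⟩
    · simpa using hhY s hsY
  · have hsb : s ∈ b := hs.resolve_right fun hsY =>
      hsX (Or.inr (Set.sUnion_mono (fun d hd => hd.1) hsY))
    rw [hhb s hsb]
    exact hl s fun h => hsX h.1

/-- Let `U ⊆ b` be faces and `t ∉ U`. If some vector of `b` is not spanned by `t` and `U`, then
there is a face between `U` and `b` that avoids `t` and differs from `U`. -/
theorem exists_isFaceOf_between {S E : Type*} [Finite S] [AddCommGroup E] [Module ℝ E]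
    {A : S → E} {U b : Set S} (hU : IsFaceOf A U) (hb : IsFaceOf A b) (hUb : U ⊆ b)
    {t s : S} (ht : t ∉ U) (hsb : s ∈ b)
    (hs : A s ∉ Submodule.span ℝ (A '' insert t U)) :
    ∃ F, IsFaceOf A F ∧ U ⊆ F ∧ F ⊆ b ∧ t ∉ F ∧ ∃ p ∈ F, p ∉ U := by
  obtain ⟨f, hf0, hf⟩ := hU
  obtain ⟨g, hgs, hg0⟩ : ∃ g : E →ₗ[ℝ] ℝ, g (A s) < 0 ∧ ∀ u ∈ insert t U, g (A u) = 0 := by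
    obtain ⟨g, hgs, hg⟩ := Submodule.exists_le_ker_of_notMem hs
    have hg0 : ∀ u ∈ insert t U, g (A u) = 0 := fun u hu =>
      hg (Submodule.subset_span (Set.mem_image_of_mem A hu))
    rcases lt_or_gt_of_ne hgs with h | h
    · exact ⟨g, h, hg0⟩
    · exact ⟨-g, by simpa using h, fun u hu => by simp [hg0 u hu]⟩
  have hsU : s ∉ U := fun h => hgs.ne (hg0 s (Set.mem_insert_of_mem _ h))
  obtain ⟨p, hp, hmin⟩ := Set.exists_min_image (b \ U) (fun u => g (A u) / f (A u))
    (Set.toFinite _) ⟨s, hsb, hsU⟩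
  set m := g (A p) / f (A p) with hm
  have hm0 : m < 0 := (hmin s ⟨hsb, hsU⟩).trans_lt (div_neg_of_neg_of_pos hgs (hf s hsU))
  set h : E →ₗ[ℝ] ℝ := g - m • f with hh
  have hhU : ∀ u ∈ U, h (A u) = 0 := fun u hu => by
    simp [hh, hf0 u hu, hg0 u (Set.mem_insert_of_mem _ hu)]
  have hhb : ∀ u ∈ b, 0 ≤ h (A u) := fun u hu => by
    by_cases huU : u ∈ U
    · exact (hhU u huU).ge
    · have := (le_div_iff₀ (hf u huU)).mp (hmin u ⟨hu, huU⟩)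
      simpa [hh] using this
  refine ⟨{u ∈ b | h (A u) = 0}, ?_, fun u hu => ⟨hUb hu, hhU u hu⟩, fun u hu => hu.1, ?_,
    p, ⟨hp.1, ?_⟩, hp.2⟩
  · exact hb.of_subset (fun u hu => hu.1) h (fun u hu => hu.2) fun u hu hne =>
      (hhb u hu).lt_of_ne fun h0 => hne ⟨hu, h0.symm⟩
  · rintro ⟨-, h0⟩
    have : h (A t) = -(m * f (A t)) := by simp [hh, hg0 t (Set.mem_insert _ _)]
    have := mul_neg_of_neg_of_pos hm0 (hf t ht)
    linarith
  · have := (hf p hp.2).ne'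
    simp [hh, hm, this]

/-- In a maximal acyclic nested set, the contraction of `A` restricted to a member `b` by
`properUnion N b` has rank at most one. -/
theorem mem_span_of_maximal_acyclic_nested {S E : Type*} [Fintype S] [AddCommGroup E]
    [Module ℝ E] {A : S → E} {B N : Set (Set S)} (hB : IsOrientedBuilding A B)
    (hN : IsBoolNested B N) (hA : ∀ N' ⊆ N, IsFaceOf A (⋃₀ N'))
    (hmax : ∀ M : Set (Set S), IsBoolNested B M → (∀ M' ⊆ M, IsFaceOf A (⋃₀ M')) →
      N ⊆ M → N = M)
    {b : Set S} (hb : b ∈ N) {t s : S} (htb : t ∈ b) (ht : t ∉ properUnion N b) (hsb : s ∈ b) :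
    A s ∈ Submodule.span ℝ (A '' insert t (properUnion N b)) := by
  by_contra hs
  have hbface : IsFaceOf A b := by simpa using hA {b} (by simpa using hb)
  obtain ⟨F, hF, hUF, hFb, htF, p, hpF, hpU⟩ := exists_isFaceOf_between
    (hA {d ∈ N | d ⊂ b} fun d hd => hd.1) hbface (properUnion_subset N b) ht hsb hs
  obtain ⟨c, hpc, hc⟩ := (Set.toFinite {d : Set S | d ∈ B ∧ d ⊆ F}).exists_le_maximal
    (a := {p}) ⟨hB.1.2.1 p, by simpa using hpF⟩
  have hcN : c ∈ N := by
    rw [hmax (insert c N) (hN.insert hB.1 hb hUF hFb hc)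
      (isFaceOf_sUnion_insert hB hN hA hb hF hUF hFb hc) (Set.subset_insert _ _)]
    exact Set.mem_insert _ _
  exact hpU (subset_properUnion hcN ⟨hc.prop.2.trans hFb, fun h => htF (hc.prop.2 (h htb))⟩
    (hpc rfl))

/-- Vectors chosen in each member of an acyclic nested set, outside the strictly smaller members,
are linearly independent. -/
theorem linearIndependent_of_acyclic_nested {S E : Type*} [Finite S] [AddCommGroup E]
    [Module ℝ E] {A : S → E} {B N : Set (Set S)} (hN : IsBoolNested B N)
    (hA : ∀ N' ⊆ N, IsFaceOf A (⋃₀ N')) (t : N → S) (ht : ∀ b : N, t b ∈ b.1)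
    (htU : ∀ b : N, t b ∉ properUnion N b.1) : LinearIndependent ℝ fun b => A (t b) := by
  have := Fintype.ofFinite N
  rw [Fintype.linearIndependent_iff]
  intro δ hδ
  by_contra! hne
  obtain ⟨i, hi⟩ := hne
  obtain ⟨m, -, hm⟩ := (Set.toFinite {b : N | δ b ≠ 0}).exists_le_maximal (a := i) hi
  obtain ⟨f, hf0, hf⟩ := hA {d | ∃ b : N, δ b ≠ 0 ∧ b ≠ m ∧ d = b.1}
    (by rintro _ ⟨b, -, -, rfl⟩; exact b.2)
  have hpos := hf (t m) (by
    rintro ⟨_, ⟨b, hδb, hbm, rfl⟩, hmem⟩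
    rcases hN.2.2.1 b.1 b.2 m.1 m.2 with h | h | h
    · exact htU m (subset_properUnion b.2
        (h.ssubset_of_ne fun heq => hbm (Subtype.ext heq)) hmem)
    · exact hbm (hm.eq_of_le hδb h).symm
    · exact Set.notMem_empty _ (h ▸ Set.mem_inter hmem (ht m)))
  have hsum := congrArg f hδ
  rw [map_sum, map_zero, Finset.sum_eq_single m] at hsum
  · rw [map_smul, smul_eq_mul, mul_eq_zero] at hsum
    exact hsum.elim hm.prop hpos.ne'
  · intro b _ hbm
    by_cases hδb : δ b = 0
    · simp [hδb]
    · rw [map_smul, hf0 (t b) ⟨b.1, ⟨b, hδb, hbm, rfl⟩, ht b⟩, smul_zero]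
  · simp

/-- A maximal acyclic nested set has as many members as the rank of the family. -/
theorem ncard_eq_finrank_of_maximal_acyclic_nested {S E : Type*} [Fintype S] [AddCommGroup E]
    [Module ℝ E] {A : S → E} {B N : Set (Set S)} (hB : IsOrientedBuilding A B)
    (hN : IsBoolNested B N) (hA : ∀ N' ⊆ N, IsFaceOf A (⋃₀ N'))
    (hmax : ∀ M : Set (Set S), IsBoolNested B M → (∀ M' ⊆ M, IsFaceOf A (⋃₀ M')) →
      N ⊆ M → N = M) :
    N.ncard = Module.finrank ℝ (Submodule.span ℝ (Set.range A)) := by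
  choose t ht htU using fun b : N => hN.exists_mem_notMem_properUnion hB.1 b.2
  have hspan : ∀ b ∈ N, ∀ s ∈ b, A s ∈ Submodule.span ℝ (Set.range fun b => A (t b)) := by
    intro b
    induction b using (wellFounded_lt (α := Set S)).induction with
    | _ b ih =>
      intro hb s hs
      refine Submodule.span_le.mpr ?_ (mem_span_of_maximal_acyclic_nested hB hN hA hmax hb
        (ht ⟨b, hb⟩) (htU ⟨b, hb⟩) hs)
      rintro _ ⟨u, rfl | ⟨d, hd, hud⟩, rfl⟩
      · exact Submodule.subset_span ⟨⟨b, hb⟩, rfl⟩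
      · exact ih d hd.2 hd.1 u hud
  have heq : Submodule.span ℝ (Set.range A) = Submodule.span ℝ (Set.range fun b => A (t b)) := by
    refine le_antisymm (Submodule.span_le.mpr ?_) (Submodule.span_mono ?_)
    · rintro _ ⟨s, rfl⟩
      obtain ⟨b, hsb, hb⟩ := (Set.toFinite B).exists_le_maximal (hB.1.2.1 s)
      exact hspan b (hN.2.1 ⟨hb.prop, fun d hd hbd => hb.eq_of_le hd hbd⟩) s (hsb rfl)
    · rintro _ ⟨b, rfl⟩
      exact Set.mem_range_self _
  have := Fintype.ofFinite N
  rw [heq, finrank_span_eq_card (linearIndependent_of_acyclic_nested hN hA t ht htU),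
    ← Nat.card_eq_fintype_card, Nat.card_coe_set_eq]

/-- **Purity of the acyclic nested complex** (Corollary `pureAcyclicNestedComplex`). Let `A` be
a finite family of vectors of a finite-dimensional real inner product space and `B` an
oriented building set for `A`.  Every nested set on `B` acyclic for `A` that is maximal under
inclusion among such has exactly `r = dim span {A s : s ∈ S}` elements; consequently every
acyclic nested set extends to a maximal one, whose corresponding face `M ∖ boolConn B` of the
acyclic nested complex has cardinality `r − |boolConn B|` (so the complex is pure of dimension
`r − |boolConn B| − 1`). -/
theorem acyclic_nested_complex_pure {S E : Type*} [NormedAddCommGroup E]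
    [InnerProductSpace ℝ E] [FiniteDimensional ℝ E] [Fintype S]
    (A : S → E) (B : Set (Set S)) (hB : IsOrientedBuilding A B) :
    (∀ N : Set (Set S), IsBoolNested B N → (∀ N' ⊆ N, IsFaceOf A (⋃₀ N')) →
      (∀ M : Set (Set S), IsBoolNested B M → (∀ M' ⊆ M, IsFaceOf A (⋃₀ M')) →
        N ⊆ M → N = M) →
      N.ncard = Module.finrank ℝ (Submodule.span ℝ (Set.range A))) ∧
    (∀ N : Set (Set S), IsBoolNested B N → (∀ N' ⊆ N, IsFaceOf A (⋃₀ N')) →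
      ∃ M : Set (Set S), IsBoolNested B M ∧ (∀ M' ⊆ M, IsFaceOf A (⋃₀ M')) ∧ N ⊆ M ∧
        (M \ boolConn B).ncard =
          Module.finrank ℝ (Submodule.span ℝ (Set.range A)) - (boolConn B).ncard) := by
  refine ⟨fun N hN hA hmax => ncard_eq_finrank_of_maximal_acyclic_nested hB hN hA hmax,
    fun N hN hA => ?_⟩
  obtain ⟨M, hNM, hM⟩ := (Set.toFinite {M : Set (Set S) | IsBoolNested B M ∧
    ∀ M' ⊆ M, IsFaceOf A (⋃₀ M')}).exists_le_maximal (a := N) ⟨hN, hA⟩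
  refine ⟨M, hM.prop.1, hM.prop.2, hNM, ?_⟩
  rw [Set.ncard_sdiff hM.prop.1.2.1, ncard_eq_finrank_of_maximal_acyclic_nested hB hM.prop.1
    hM.prop.2 fun M' h h' hsub => hM.eq_of_le ⟨h, h'⟩ hsub]
end

section
/- Let E be a finite-dimensional real inner product space, A = (a_s)_{s∈S} a finite, linearly dependent family of vectors of E, and 𝓑 an oriented building set for A, with weights ρ ∈ ℝ^𝓑 given by ρ_B = 0 if |B| = 1 and ρ_B = R^{|B|} if |B| ≥ 2, where R = |𝓑| · max_c r_c (maximum over all circuit supports c of A). If N is a nested set on 𝓑 that is acyclic for A, then the convex hull of the points {v_{N''}(ρ) : N'' a maximal nested set on 𝓑 with N ⊆ N''} has nonempty intersection with the evaluation space E(A). -/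
/-- The ratio `max |δ_s| / min |δ_s|`, over the support of `δ`. -/
noncomputable def depRatio {S : Type*} (δ : S → ℝ) : ℝ :=
  (⨆ s : {s : S // δ s ≠ 0}, |δ s.val|) / (⨅ s : {s : S // δ s ≠ 0}, |δ s.val|)

/-- The ratio `r_c = max_{s ∈ c} |δ_s| / min_{s ∈ c} |δ_s|` for a dependence `δ` of `A`
with support `c` (when `c` is a circuit support, `δ` is unique up to nonzero scaling, so the
ratio does not depend on the choice). -/
noncomputable def circuitRatio {S E : Type*} [Fintype S] [AddCommGroup E] [Module ℝ E]
    (A : S → E) (c : Set S) : ℝ :=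
  ⨆ δ : {δ : S → ℝ // δ ≠ 0 ∧ ∑ s, δ s • A s = 0 ∧ c = {s | δ s ≠ 0}}, depRatio δ.val

/-- The constant `R = |B| · max_c r_c`, the maximum ranging over the circuit supports of `A`. -/
noncomputable def bigR {S E : Type*} [Fintype S] [AddCommGroup E] [Module ℝ E]
    (A : S → E) (B : Set (Set S)) : ℝ :=
  (B.ncard : ℝ) * ⨆ c : {c : Set S // IsCircuitSupport A c}, circuitRatio A c.val

/-- The weights `ρ ∈ ℝ^B`: `ρ_b = 0` if `|b| = 1` and `ρ_b = R^{|b|}` otherwise. -/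
noncomputable def nestWeight {S E : Type*} [Fintype S] [AddCommGroup E] [Module ℝ E]
    (A : S → E) (B : Set (Set S)) (b : Set S) : ℝ :=
  if b.ncard = 1 then 0 else bigR A B ^ b.ncard

/-- The vertex `v_N(ρ)` of the nestohedron associated with a maximal nested set `N` on `B`:
its coordinate at `s` is the sum of the weights `ρ_b` over the blocks `b ∈ B` with
`s ∈ b ⊆ κ_s(N)`, where `κ_s(N)` is the inclusion-minimal member of `N` containing `s`
(equivalently, `b` is contained in every member of `N` containing `s`). -/
noncomputable def nestVertex {S E : Type*} [Fintype S] [AddCommGroup E] [Module ℝ E]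
    (A : S → E) (B : Set (Set S)) (N : Set (Set S)) : S → ℝ :=
  fun s => ∑ᶠ b ∈ {b : Set S | b ∈ B ∧ s ∈ b ∧ ∀ c ∈ N, s ∈ c → b ⊆ c}, nestWeight A B b

/-- The evaluation space of `A`: the subspace of `ℝ^S` consisting of the evaluations of the
linear functionals of `E` on the family `A`. -/
def evalSpace {S E : Type*} [AddCommGroup E] [Module ℝ E] (A : S → E) : Set (S → ℝ) :=
  {x | ∃ f : E →ₗ[ℝ] ℝ, ∀ s, x s = f (A s)}

/-- `N` is a maximal (under inclusion) nested set on the building set `B`. -/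
def IsMaxNested {S : Type*} (B N : Set (Set S)) : Prop :=
  IsBoolNested B N ∧ ∀ M : Set (Set S), IsBoolNested B M → N ⊆ M → N = M

open scoped Classical in
/-- The elements of `b` all of whose enclosing members of `N` contain the whole of `b`. -/
noncomputable def nestTop {S : Type*} [Fintype S] (N : Set (Set S)) (b : Set S) : Finset S :=
  {s | s ∈ b ∧ ∀ c ∈ N, s ∈ c → b ⊆ c}

theorem mem_nestTop {S : Type*} [Fintype S] {N : Set (Set S)} {b : Set S} {s : S} :
    s ∈ nestTop N b ↔ s ∈ b ∧ ∀ c ∈ N, s ∈ c → b ⊆ c := by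
  simp [nestTop]

/-- A block together with members of the building set which all meet it is again a block. -/
theorem IsBoolBuilding.union_sup_mem {S : Type*} {B : Set (Set S)} (hB : IsBoolBuilding B)
    {b : Set S} (hb : b ∈ B) (F : Finset (Set S)) (hF : ∀ c ∈ F, c ∈ B ∧ (c ∩ b).Nonempty) :
    b ∪ F.sup id ∈ B := by
  classical
  induction F using Finset.induction_on with
  | empty => simpa using hb
  | insert c F _ ih =>
    have h := ih fun d hd => hF d (Finset.mem_insert_of_mem hd)
    obtain ⟨hc, x, hxc, hxb⟩ := hF c (Finset.mem_insert_self _ _)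
    have := hB.2.2 _ h c hc ⟨x, Or.inl hxb, hxc⟩
    rw [Finset.sup_insert]
    convert this using 1
    ext y
    simp only [id, Set.sup_eq_union, Set.mem_union]
    tauto

/-- A block covered by members of a nested set is contained in one of them. -/
theorem IsBoolNested.exists_superset_of_subset_sUnion {S : Type*} [Fintype S]
    {B N : Set (Set S)} (hB : IsBoolBuilding B) (hN : IsBoolNested B N) {b : Set S} (hb : b ∈ B)
    {F : Set (Set S)} (hF : F ⊆ N) (hbF : b ⊆ ⋃₀ F) : ∃ c ∈ F, b ⊆ c := by
  classical
  obtain ⟨hNB, -, hlam, hdisj⟩ := hN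
  set G : Set (Set S) := {c | c ∈ F ∧ (c ∩ b).Nonempty} with hG
  set H : Finset (Set S) := (Set.toFinite {c | Maximal (· ∈ G) c}).toFinset with hH
  have memH : ∀ c, c ∈ H ↔ Maximal (· ∈ G) c := by simp [hH]
  have hcover : b ⊆ H.sup id := by
    intro x hx
    obtain ⟨c, hcF, hxc⟩ := hbF hx
    obtain ⟨d, hcd, hd⟩ := (Set.toFinite G).exists_le_maximal (a := c) ⟨hcF, x, hxc, hx⟩
    exact Finset.le_sup (f := id) ((memH d).2 hd) (hcd hxc)
  have hmem : H.sup id ∈ B := by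
    have := hB.union_sup_mem hb H fun c hc =>
      ⟨hNB (hF ((memH c).1 hc).prop.1), ((memH c).1 hc).prop.2⟩
    rwa [Set.union_eq_self_of_subset_left hcover] at this
  have hpair : (↑H : Set (Set S)).Pairwise (fun c d => c ∩ d = ∅) := by
    intro c hc d hd hne
    have hc' := (memH c).1 hc
    have hd' := (memH d).1 hd
    rcases hlam c (hF hc'.prop.1) d (hF hd'.prop.1) with h | h | h
    · exact absurd (hc'.eq_of_le hd'.prop h) hne
    · exact absurd (hd'.eq_of_le hc'.prop h).symm hne
    · exact h
  have hcard : H.card < 2 := by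
    by_contra hcon
    exact hdisj H (fun c hc => hF ((memH c).1 hc).prop.1) (by omega) hpair hmem
  obtain ⟨x, hx⟩ := hB.1 b hb
  have hne : H.Nonempty := by
    rw [Finset.nonempty_iff_ne_empty]
    intro h0
    have := hcover hx
    simp [h0] at this
  obtain ⟨c, hc⟩ := Finset.card_eq_one.1 (by have := hne.card_pos; omega : H.card = 1)
  refine ⟨c, ((memH c).1 (by simp [hc])).prop.1, ?_⟩
  simpa [hc] using hcover

theorem IsBoolNested.nestTop_nonempty {S : Type*} [Fintype S]
    {B N : Set (Set S)} (hB : IsBoolBuilding B) (hN : IsBoolNested B N) {b : Set S} (hb : b ∈ B) :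
    (nestTop N b).Nonempty := by
  by_contra hcon
  rw [Finset.not_nonempty_iff_eq_empty] at hcon
  obtain ⟨c, hc, hbc⟩ := hN.exists_superset_of_subset_sUnion hB hb
    (F := {c | c ∈ N ∧ ¬ b ⊆ c}) (fun c hc => hc.1) (by
      intro s hs
      by_contra hs'
      have : s ∈ nestTop N b := mem_nestTop.2 ⟨hs, fun c hc hsc => by
        by_contra hbc
        exact hs' ⟨c, ⟨hc, hbc⟩, hsc⟩⟩
      simp [hcon] at this)
  exact hc.2 hbc

section KeyOrder

variable {S L : Type*} [LinearOrder L]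

/-- The union of the blocks of `B` whose first element with respect to the key `k` is `s`. -/
def keyBlock (B : Set (Set S)) (k : S → L) (s : S) : Set S :=
  ⋃₀ {b | b ∈ B ∧ s ∈ b ∧ ∀ t ∈ b, k s ≤ k t}

theorem subset_keyBlock {B : Set (Set S)} {k : S → L} {s : S} {b : Set S} (hb : b ∈ B)
    (hs : s ∈ b) (hmin : ∀ t ∈ b, k s ≤ k t) : b ⊆ keyBlock B k s :=
  Set.subset_sUnion_of_mem ⟨hb, hs, hmin⟩

theorem self_mem_keyBlock {B : Set (Set S)} (hB : IsBoolBuilding B) (k : S → L) (s : S) :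
    s ∈ keyBlock B k s :=
  subset_keyBlock (hB.2.1 s) (Set.mem_singleton s) (by simp) (Set.mem_singleton s)

theorem key_le_of_mem_keyBlock {B : Set (Set S)} {k : S → L} {s t : S}
    (ht : t ∈ keyBlock B k s) : k s ≤ k t := by
  obtain ⟨b, ⟨-, -, hmin⟩, htb⟩ := ht
  exact hmin t htb

theorem keyBlock_mem [Finite S] {B : Set (Set S)} (hB : IsBoolBuilding B) (k : S → L) (s : S) :
    keyBlock B k s ∈ B := by
  set F : Finset (Set S) := (Set.toFinite {b | b ∈ B ∧ s ∈ b ∧ ∀ t ∈ b, k s ≤ k t}).toFinset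
    with hF
  have h := hB.union_sup_mem (hB.2.1 s) F (by
    intro c hc
    simp only [hF, Set.Finite.mem_toFinset, Set.mem_ofPred_eq] at hc
    exact ⟨hc.1, s, hc.2.1, rfl⟩)
  convert h using 1
  ext x
  constructor
  · rintro ⟨b, hb, hxb⟩
    have hbF : b ∈ F := by simpa [hF] using hb
    exact Or.inr (Finset.le_sup (f := id) hbF hxb)
  · rintro (hx | hx)
    · rw [Set.mem_singleton_iff.1 hx]
      exact self_mem_keyBlock hB k s
    · have : F.sup id ≤ keyBlock B k s := Finset.sup_le fun b hb =>
        Set.subset_sUnion_of_mem (by simpa [hF] using hb)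
      exact this hx

/-- A block meeting `keyBlock B k s` and with no element before `s` is contained in it. -/
theorem subset_keyBlock_of_inter [Finite S] {B : Set (Set S)} (hB : IsBoolBuilding B) {k : S → L} {s : S}
    {b : Set S} (hb : b ∈ B) (hne : (b ∩ keyBlock B k s).Nonempty)
    (hmin : ∀ t ∈ b, k s ≤ k t) : b ⊆ keyBlock B k s :=
  Set.subset_union_left.trans <| subset_keyBlock (hB.2.2 _ hb _ (keyBlock_mem hB k s) hne)
    (Or.inr (self_mem_keyBlock hB k s)) fun t ht => ht.elim (hmin t) key_le_of_mem_keyBlock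

theorem exists_first [Finite S] {B : Set (Set S)} (hB : IsBoolBuilding B) (k : S → L) {b : Set S}
    (hb : b ∈ B) : ∃ s ∈ b, ∀ t ∈ b, k s ≤ k t :=
  (Set.toFinite b).exists_minimalFor k b (hB.1 b hb) |>.imp fun s hs =>
    ⟨hs.prop, fun t ht => (le_total (k s) (k t)).elim id fun h => hs.le_of_le ht h⟩

theorem isBoolNested_range_keyBlock [Finite S] {B : Set (Set S)} (hB : IsBoolBuilding B) {k : S → L}
    (hk : Function.Injective k) : IsBoolNested B (Set.range (keyBlock B k)) := by
  refine ⟨?_, ?_, ?_, ?_⟩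
  · rintro _ ⟨s, rfl⟩
    exact keyBlock_mem hB k s
  · rintro c ⟨hc, hmax⟩
    obtain ⟨s, hs, hmin⟩ := exists_first hB k hc
    exact ⟨s, (hmax _ (keyBlock_mem hB k s) (subset_keyBlock hc hs hmin)).symm⟩
  · rintro _ ⟨s, rfl⟩ _ ⟨t, rfl⟩
    by_cases h : (keyBlock B k s ∩ keyBlock B k t).Nonempty
    · rcases le_total (k s) (k t) with hst | hst
      · right; left
        exact subset_keyBlock_of_inter hB (keyBlock_mem hB k t) (by rwa [Set.inter_comm])
          fun u hu => hst.trans (key_le_of_mem_keyBlock hu)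
      · left
        exact subset_keyBlock_of_inter hB (keyBlock_mem hB k s) h
          fun u hu => hst.trans (key_le_of_mem_keyBlock hu)
    · exact Or.inr (Or.inr (Set.not_nonempty_iff_eq_empty.1 h))
  · intro F hF hcard hpair hmem
    obtain ⟨s, hs, hmin⟩ := exists_first hB k hmem
    obtain ⟨c, hcF, hsc⟩ : ∃ c ∈ F, s ∈ c := by
      simpa [Finset.sup_set_eq_biUnion] using hs
    obtain ⟨t, rfl⟩ := hF hcF
    have hts : t = s := hk (le_antisymm (key_le_of_mem_keyBlock hsc)
      (hmin t (Finset.le_sup (f := id) hcF (self_mem_keyBlock hB k t))))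
    subst hts
    have hsub := subset_keyBlock hmem hs hmin
    obtain ⟨d, hdF, hne⟩ := Finset.exists_mem_ne (s := F) (by omega) (keyBlock B k t)
    obtain ⟨u, rfl⟩ := hF hdF
    have hu := self_mem_keyBlock hB k u
    have : u ∈ keyBlock B k u ∩ keyBlock B k t :=
      ⟨hu, hsub (Finset.le_sup (f := id) hdF hu)⟩
    rw [hpair hdF hcF hne] at this
    exact this

theorem isMaxNested_range_keyBlock [Fintype S] {B : Set (Set S)} (hB : IsBoolBuilding B) {k : S → L}
    (hk : Function.Injective k) : IsMaxNested B (Set.range (keyBlock B k)) := by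
  refine ⟨isBoolNested_range_keyBlock hB hk, fun M hM hsub => hsub.antisymm fun X hX => ?_⟩
  obtain ⟨s, hs, hmin⟩ := exists_first hB k (hM.1 hX)
  have hXs := subset_keyBlock (hM.1 hX) hs hmin
  obtain ⟨c, hc, hsc⟩ := hM.exists_superset_of_subset_sUnion hB (keyBlock_mem hB k s)
    (F := insert X (keyBlock B k '' {t | t ∈ keyBlock B k s ∧ t ≠ s})) (by
      rintro c (rfl | ⟨t, -, rfl⟩)
      · exact hX
      · exact hsub ⟨t, rfl⟩) (by
      intro t ht
      by_cases hts : t = s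
      · subst hts
        exact ⟨X, Set.mem_insert _ _, hs⟩
      · exact ⟨_, Or.inr ⟨t, ⟨ht, hts⟩, rfl⟩, self_mem_keyBlock hB k t⟩)
  rcases hc with rfl | ⟨t, ⟨ht, hts⟩, rfl⟩
  · exact ⟨s, hsc.antisymm hXs⟩
  · exact absurd (hk (le_antisymm
      (key_le_of_mem_keyBlock (hsc (self_mem_keyBlock hB k s))) (key_le_of_mem_keyBlock ht))) hts

theorem nestTop_range_keyBlock [Fintype S] {B : Set (Set S)} (hB : IsBoolBuilding B) {k : S → L}
    (hk : Function.Injective k) {b : Set S} (hb : b ∈ B) {s : S} (hs : s ∈ b)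
    (hmin : ∀ t ∈ b, k s ≤ k t) : nestTop (Set.range (keyBlock B k)) b = {s} := by
  ext t
  rw [mem_nestTop, Finset.mem_singleton]
  constructor
  · rintro ⟨htb, ht⟩
    exact hk (le_antisymm
      (key_le_of_mem_keyBlock (ht _ ⟨t, rfl⟩ (self_mem_keyBlock hB k t) hs)) (hmin t htb))
  · rintro rfl
    refine ⟨hs, ?_⟩
    rintro _ ⟨u, rfl⟩ hu
    exact subset_keyBlock_of_inter hB hb ⟨t, hs, hu⟩
      fun v hv => (key_le_of_mem_keyBlock hu).trans (hmin v hv)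

theorem subset_range_keyBlock [Fintype S] {B N : Set (Set S)} (hB : IsBoolBuilding B) (hN : N ⊆ B)
    {k : S → L} (htop : ∀ b ∈ B, ∀ s ∈ b, (∀ t ∈ b, k s ≤ k t) → s ∈ nestTop N b) :
    N ⊆ Set.range (keyBlock B k) := by
  intro K hK
  obtain ⟨s, hs, hmin⟩ := exists_first hB k (hN hK)
  have := htop _ (keyBlock_mem hB k s) s (self_mem_keyBlock hB k s)
    fun t ht => key_le_of_mem_keyBlock ht
  exact ⟨s, ((mem_nestTop.1 this).2 K hK hs).antisymm (subset_keyBlock (hN hK) hs hmin)⟩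

end KeyOrder

/-- Any nested set extends to a maximal one which selects, in each block, a top element at which
a given function `δ` is minimal. -/
theorem IsBoolNested.exists_isMaxNested_argmin {S : Type*} [Fintype S] [Nonempty S]
    {B N : Set (Set S)} (hB : IsBoolBuilding B) (hN : IsBoolNested B N) (δ : S → ℝ) :
    ∃ M, IsMaxNested B M ∧ N ⊆ M ∧ ∃ p : Set S → S, ∀ b ∈ B, nestTop M b = {p b} ∧
      p b ∈ nestTop N b ∧ ∀ s ∈ nestTop N b, δ (p b) ≤ δ s := by
  classical
  let depth : S → ℕ := fun s => {c | c ∈ N ∧ s ∈ c}.ncard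
  let k : S → ℕ ×ₗ ℝ ×ₗ Fin (Fintype.card S) :=
    fun s => toLex (depth s, toLex (δ s, Fintype.equivFin S s))
  have hk : Function.Injective k := by
    intro s t h
    simp only [k, EmbeddingLike.apply_eq_iff_eq, Prod.mk.injEq] at h
    exact h.2.2
  have hdepth : ∀ b, ∀ s ∈ nestTop N b, ∀ t ∈ b, t ∉ nestTop N b → depth s < depth t := by
    intro b s hs t ht htn
    rw [mem_nestTop] at hs htn
    push Not at htn
    obtain ⟨c, hc, htc, hbc⟩ := htn ht
    refine Set.ncard_lt_ncard ⟨fun d hd => ⟨hd.1, hs.2 d hd.1 hd.2 ht⟩, fun hsub => ?_⟩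
      (Set.toFinite _)
    exact hbc (hs.2 c hc (hsub ⟨hc, htc⟩).2)
  have htop : ∀ b ∈ B, ∀ s ∈ b, (∀ t ∈ b, k s ≤ k t) → s ∈ nestTop N b := by
    intro b hb s hs hmin
    by_contra hsn
    obtain ⟨u, hu⟩ := hN.nestTop_nonempty hB hb
    have h1 := hdepth b u hu s hs hsn
    have h2 := hmin u (mem_nestTop.1 hu).1
    simp only [k, Prod.Lex.le_iff, ofLex_toLex] at h2
    omega
  choose! p hp hpmin using fun b (hb : b ∈ B) => exists_first hB k hb
  refine ⟨_, isMaxNested_range_keyBlock hB hk, subset_range_keyBlock hB hN.1 htop, p,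
    fun b hb => ⟨nestTop_range_keyBlock hB hk hb (hp b hb) (hpmin b hb),
      htop b hb _ (hp b hb) (hpmin b hb), fun s hs => ?_⟩⟩
  have hpt := mem_nestTop.1 (htop b hb _ (hp b hb) (hpmin b hb))
  have hst := mem_nestTop.1 hs
  have h2 := hpmin b hb s hst.1
  have heq : depth s = depth (p b) := by
    have : {c | c ∈ N ∧ s ∈ c} = {c | c ∈ N ∧ p b ∈ c} := by
      ext c
      exact ⟨fun h => ⟨h.1, hst.2 c h.1 h.2 hpt.1⟩, fun h => ⟨h.1, hpt.2 c h.1 h.2 hst.1⟩⟩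
    simp only [depth, this]
  simp only [k, Prod.Lex.le_iff, ofLex_toLex, heq] at h2
  rcases h2 with h | ⟨-, h | ⟨h, -⟩⟩
  · omega
  · exact h.le
  · exact h.le

/-- A support-minimal nonzero linear dependence of `A`. -/
def IsCircuitDep {S E : Type*} [Fintype S] [AddCommGroup E] [Module ℝ E]
    (A : S → E) (γ : S → ℝ) : Prop :=
  γ ≠ 0 ∧ ∑ s, γ s • A s = 0 ∧
    ∀ δ' : S → ℝ, δ' ≠ 0 → ∑ s, δ' s • A s = 0 →
      {s | δ' s ≠ 0} ⊆ {s | γ s ≠ 0} → {s | δ' s ≠ 0} = {s | γ s ≠ 0}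

theorem IsCircuitDep.isCircuitSupport {S E : Type*} [Fintype S] [AddCommGroup E] [Module ℝ E]
    {A : S → E} {γ : S → ℝ} (h : IsCircuitDep A γ) : IsCircuitSupport A {s | γ s ≠ 0} :=
  ⟨γ, h.1, h.2.1, rfl, h.2.2⟩

/-- The nonzero entries of `γ` have the same sign as the corresponding entries of `δ`. -/
def SignConformal {S : Type*} (γ δ : S → ℝ) : Prop :=
  ∀ s, (0 < γ s → 0 < δ s) ∧ (γ s < 0 → δ s < 0)

theorem SignConformal.trans {S : Type*} {γ δ ε : S → ℝ} (h : SignConformal γ δ) (h' : SignConformal δ ε) :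
    SignConformal γ ε :=
  fun s => ⟨fun hs => (h' s).1 ((h s).1 hs), fun hs => (h' s).2 ((h s).2 hs)⟩

theorem SignConformal.smul {S : Type*} {γ δ : S → ℝ} (h : SignConformal γ δ) {a : ℝ} (ha : 0 < a) :
    SignConformal (a • γ) δ := by
  intro s
  simp only [Pi.smul_apply, smul_eq_mul]
  exact ⟨fun hs => (h s).1 (pos_of_mul_pos_right hs ha.le),
    fun hs => (h s).2 (by by_contra hc; push Not at hc; nlinarith [mul_nonneg ha.le hc])⟩

theorem SignConformal.ne_zero {S : Type*} {γ δ : S → ℝ} (h : SignConformal γ δ) {s : S} (hs : γ s ≠ 0) :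
    δ s ≠ 0 := by
  rcases lt_or_gt_of_ne hs with h' | h'
  · exact ((h s).2 h').ne
  · exact ((h s).1 h').ne'

/-- Subtracting a suitable multiple of `γ` cancels an entry of `δ` without sign changes. -/
theorem exists_conformal_sub_smul {S : Type*} [Fintype S] {δ γ : S → ℝ}
    (hsupp : ∀ s, γ s ≠ 0 → δ s ≠ 0) (hpos : ∃ s, 0 < γ s * δ s) :
    ∃ a : ℝ, 0 < a ∧ SignConformal (δ - a • γ) δ ∧ ∃ s, δ s ≠ 0 ∧ (δ - a • γ) s = 0 := by
  classical
  obtain ⟨s₀, hs₀⟩ := hpos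
  obtain ⟨m, hm, hmin⟩ := Finset.exists_min_image
    (Finset.univ.filter fun s => 0 < γ s * δ s) (fun s => δ s / γ s) ⟨s₀, by simpa using hs₀⟩
  simp only [Finset.mem_filter, Finset.mem_univ, true_and] at hm hmin
  have hγm : γ m ≠ 0 := left_ne_zero_of_mul hm.ne'
  have ha : 0 < δ m / γ m := by
    rw [div_pos_iff]
    rcases mul_pos_iff.1 hm with h | h
    · exact Or.inl h.symm
    · exact Or.inr h.symm
  refine ⟨δ m / γ m, ha, fun s => ?_, m, hsupp m hγm, by simp [hγm]⟩
  simp only [Pi.sub_apply, Pi.smul_apply, smul_eq_mul]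
  rcases lt_trichotomy (γ s) 0 with hg | hg | hg
  · rcases lt_or_gt_of_ne (hsupp s hg.ne) with hd | hd
    · have h := hmin s (mul_pos_of_neg_of_neg hg hd)
      rw [le_div_iff_of_neg hg] at h
      exact ⟨fun h' => by linarith, fun _ => hd⟩
    · exact ⟨fun _ => hd, fun h' => by nlinarith⟩
  · simp [hg]
  · rcases lt_or_gt_of_ne (hsupp s hg.ne') with hd | hd
    · exact ⟨fun h' => by nlinarith, fun _ => hd⟩
    · have h := hmin s (mul_pos hg hd)
      rw [le_div_iff₀ hg] at h
      exact ⟨fun _ => hd, fun h' => by linarith⟩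

/-- Every linear dependence is a conformal sum of circuit dependences. -/
theorem mem_closure_conformal_circuits {S E : Type*} [Fintype S] [AddCommGroup E] [Module ℝ E]
    (A : S → E) (δ : S → ℝ) (hδ : ∑ s, δ s • A s = 0) :
    δ ∈ AddSubmonoid.closure {γ | IsCircuitDep A γ ∧ SignConformal γ δ} := by
  induction hn : {s | δ s ≠ 0}.ncard using Nat.strong_induction_on generalizing δ with
  | _ n ih =>
  have smaller : ∀ x : S → ℝ, ∑ s, x s • A s = 0 → SignConformal x δ → (∃ s, δ s ≠ 0 ∧ x s = 0) →
      x ∈ AddSubmonoid.closure {γ | IsCircuitDep A γ ∧ SignConformal γ δ} := by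
    rintro x hx hxδ ⟨s, hs, hs'⟩
    have hlt : {s | x s ≠ 0}.ncard < n := by
      rw [← hn]
      exact Set.ncard_lt_ncard ⟨fun t ht => hxδ.ne_zero ht, fun h => h hs hs'⟩ (Set.toFinite _)
    refine AddSubmonoid.closure_mono ?_ (ih _ hlt x hx rfl)
    rintro γ ⟨hγ, hγx⟩
    exact ⟨hγ, hγx.trans hxδ⟩
  have lin : ∀ (a b : ℝ) (x y : S → ℝ), ∑ s, x s • A s = 0 → ∑ s, y s • A s = 0 →
      ∑ s, (a • x + b • y) s • A s = 0 := by
    intro a b x y hx hy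
    simp only [Pi.add_apply, Pi.smul_apply, smul_eq_mul, add_smul, mul_smul,
      Finset.sum_add_distrib, ← Finset.smul_sum, hx, hy, smul_zero, add_zero]
  have scale : ∀ (a : ℝ) (x : S → ℝ), ∑ s, x s • A s = 0 → ∑ s, (a • x) s • A s = 0 := by
    intro a x hx
    simpa only [zero_smul, add_zero] using lin a 0 x x hx hx
  by_cases h0 : δ = 0
  · rw [h0]
    exact zero_mem _
  by_cases hc : IsCircuitDep A δ
  · exact AddSubmonoid.subset_closure ⟨hc, fun s => ⟨id, id⟩⟩
  obtain ⟨γ, hγ0, hγ, hsub, hne⟩ : ∃ γ : S → ℝ, γ ≠ 0 ∧ ∑ s, γ s • A s = 0 ∧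
      {s | γ s ≠ 0} ⊆ {s | δ s ≠ 0} ∧ {s | γ s ≠ 0} ≠ {s | δ s ≠ 0} := by
    by_contra hcon
    push Not at hcon
    exact hc ⟨h0, hδ, fun γ h1 h2 h3 => hcon γ h1 h2 h3⟩
  have hsupp : ∀ s, γ s ≠ 0 → δ s ≠ 0 := fun s hs => hsub hs
  obtain ⟨z, hz, hz'⟩ : ∃ z, δ z ≠ 0 ∧ γ z = 0 := by
    by_contra hcon
    push Not at hcon
    exact hne (hsub.antisymm fun s hs => hcon s hs)
  have conformal_of : ∀ x : S → ℝ, (∀ s, x s ≠ 0 → δ s ≠ 0) → (¬ ∃ s, 0 < -x s * δ s) →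
      SignConformal x δ := by
    intro x hx hno s
    push Not at hno
    have := hno s
    constructor
    · intro hs
      have := hx s hs.ne'
      exact lt_of_le_of_ne (by nlinarith) this.symm
    · intro hs
      have := hx s hs.ne
      exact lt_of_le_of_ne (by nlinarith) this
  -- The case of a dependence of smaller support that is itself conformal.
  have easy : ∀ x : S → ℝ, x ≠ 0 → ∑ s, x s • A s = 0 → (∀ s, x s ≠ 0 → δ s ≠ 0) → x z = 0 →
      (¬ ∃ s, 0 < -x s * δ s) →
      δ ∈ AddSubmonoid.closure {γ | IsCircuitDep A γ ∧ SignConformal γ δ} := by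
    intro x hx0 hx hxs hxz hno
    have hconf := conformal_of x hxs hno
    obtain ⟨s, hs⟩ := Function.ne_iff.1 hx0
    obtain ⟨a, ha, h1, h2⟩ := exists_conformal_sub_smul hxs ⟨s, by
      rcases lt_or_gt_of_ne hs with h | h
      · exact mul_pos_of_neg_of_neg h ((hconf s).2 h)
      · exact mul_pos h ((hconf s).1 h)⟩
    have e1 := smaller _ (by
      have := lin 1 (-a) δ x hδ hx
      rwa [one_smul, neg_smul, ← sub_eq_add_neg] at this) h1 h2
    have e2 := smaller (a • x) (scale a x hx) (hconf.smul ha)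
      ⟨z, hz, by simp [hxz]⟩
    simpa using add_mem e1 e2
  by_cases hneg : ∃ s, 0 < -γ s * δ s
  · by_cases hpos : ∃ s, 0 < γ s * δ s
    · obtain ⟨a, ha, h1, h2⟩ := exists_conformal_sub_smul hsupp hpos
      obtain ⟨b, hb, h3, h4⟩ := exists_conformal_sub_smul (γ := -γ) (δ := δ)
        (fun s hs => hsupp s (by simpa using hs)) hneg
      have d1 := lin 1 (-a) δ γ hδ hγ
      have d2 := lin 1 b δ γ hδ hγ
      rw [one_smul, neg_smul, ← sub_eq_add_neg] at d1
      rw [one_smul] at d2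
      rw [smul_neg, sub_neg_eq_add] at h3 h4
      obtain ⟨s, hs, hs'⟩ := h2
      obtain ⟨t, ht, ht'⟩ := h4
      have hab : 0 < a + b := add_pos ha hb
      have e1 := smaller ((b / (a + b)) • (δ - a • γ)) (scale _ _ d1)
        (h1.smul (div_pos hb hab)) ⟨s, hs, by rw [Pi.smul_apply, hs', smul_zero]⟩
      have e2 := smaller ((a / (a + b)) • (δ + b • γ)) (scale _ _ d2)
        (h3.smul (div_pos ha hab)) ⟨t, ht, by rw [Pi.smul_apply, ht', smul_zero]⟩
      convert add_mem e1 e2 using 1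
      ext u
      simp only [Pi.add_apply, Pi.smul_apply, Pi.sub_apply, smul_eq_mul]
      field_simp
      ring
    · exact easy (-γ) (neg_ne_zero.2 hγ0) (by simpa using scale (-1) γ hγ)
        (fun s hs => hsupp s (by simpa using hs)) (by simpa using hz') (by simpa using hpos)
  · exact easy γ hγ0 hγ hsupp hz' hneg

theorem depRatio_nonneg {S : Type*} (δ : S → ℝ) : 0 ≤ depRatio δ :=
  div_nonneg (Real.iSup_nonneg fun _ => abs_nonneg _) (Real.iInf_nonneg fun _ => abs_nonneg _)

theorem circuitRatio_nonneg {S E : Type*} [Fintype S] [AddCommGroup E] [Module ℝ E]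
    (A : S → E) (c : Set S) : 0 ≤ circuitRatio A c :=
  Real.iSup_nonneg fun _ => depRatio_nonneg _

theorem iInf_abs_support_pos {S : Type*} [Finite S] {δ : S → ℝ} (hδ : δ ≠ 0) :
    0 < ⨅ s : {s : S // δ s ≠ 0}, |δ s.val| := by
  obtain ⟨s, hs⟩ := Function.ne_iff.1 hδ
  have : Nonempty {s : S // δ s ≠ 0} := ⟨⟨s, hs⟩⟩
  obtain ⟨m, hm⟩ := exists_eq_ciInf_of_finite (f := fun s : {s : S // δ s ≠ 0} => |δ s.val|)
  rw [← hm]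
  exact abs_pos.2 m.2

theorem abs_le_depRatio_mul_abs {S : Type*} [Finite S] (δ : S → ℝ) {u t : S}
    (ht : δ t ≠ 0) : |δ u| ≤ depRatio δ * |δ t| := by
  have hδ : δ ≠ 0 := fun h => ht (by simp [h])
  have hpos := iInf_abs_support_pos hδ
  by_cases hu : δ u = 0
  · rw [hu, abs_zero]
    exact mul_nonneg (depRatio_nonneg δ) (abs_nonneg _)
  have h1 : |δ u| ≤ ⨆ s : {s : S // δ s ≠ 0}, |δ s.val| :=
    le_ciSup (f := fun s : {s : S // δ s ≠ 0} => |δ s.val|) (Set.finite_range _).bddAbove ⟨u, hu⟩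
  have h2 : ⨅ s : {s : S // δ s ≠ 0}, |δ s.val| ≤ |δ t| :=
    ciInf_le (f := fun s : {s : S // δ s ≠ 0} => |δ s.val|) (Set.finite_range _).bddBelow ⟨t, ht⟩
  calc |δ u| ≤ _ := h1
    _ = depRatio δ * ⨅ s : {s : S // δ s ≠ 0}, |δ s.val| := by
        rw [depRatio, div_mul_cancel₀ _ hpos.ne']
    _ ≤ depRatio δ * |δ t| := mul_le_mul_of_nonneg_left h2 (depRatio_nonneg δ)

theorem depRatio_le {S : Type*} [Finite S] {δ : S → ℝ} (hδ : δ ≠ 0) {K : ℝ}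
    (h : ∀ u t, δ t ≠ 0 → |δ u| ≤ K * |δ t|) : depRatio δ ≤ K := by
  obtain ⟨s, hs⟩ := Function.ne_iff.1 hδ
  have : Nonempty {s : S // δ s ≠ 0} := ⟨⟨s, hs⟩⟩
  rw [depRatio, div_le_iff₀ (iInf_abs_support_pos hδ)]
  obtain ⟨m, hm⟩ := exists_eq_ciInf_of_finite (f := fun s : {s : S // δ s ≠ 0} => |δ s.val|)
  rw [← hm]
  exact ciSup_le fun u => h u m m.2

/-- Two dependences with the same circuit support are proportional. -/
theorem IsCircuitDep.exists_eq_smul {S E : Type*} [Fintype S] [AddCommGroup E] [Module ℝ E]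
    {A : S → E} {γ δ : S → ℝ} (h : IsCircuitDep A γ) (hδ : ∑ s, δ s • A s = 0)
    (hsupp : {s | γ s ≠ 0} = {s | δ s ≠ 0}) : ∃ a : ℝ, δ = a • γ := by
  obtain ⟨s, hs⟩ := Function.ne_iff.1 h.1
  refine ⟨δ s / γ s, ?_⟩
  by_contra hne
  have hdep : ∑ t, (δ - (δ s / γ s) • γ) t • A t = 0 := by
    simp only [Pi.sub_apply, Pi.smul_apply, smul_eq_mul, sub_smul, mul_smul,
      Finset.sum_sub_distrib, ← Finset.smul_sum, hδ, h.2.1, smul_zero, sub_zero]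
  have heq := h.2.2 _ (sub_ne_zero.2 hne) hdep (by
    intro t ht hγt
    have hδt : δ t = 0 := by
      by_contra hcon
      have : t ∈ {s | γ s ≠ 0} := hsupp ▸ hcon
      exact this hγt
    exact ht (by simp [hγt, hδt]))
  have hs' : s ∈ {s | γ s ≠ 0} := hs
  rw [← heq] at hs'
  apply hs'
  have : γ s ≠ 0 := hs
  simp [this]

/-- The entries of a circuit dependence differ at most by the factor `max_c r_c`. -/
theorem IsCircuitDep.abs_le_mul_abs {S E : Type*} [Fintype S] [AddCommGroup E] [Module ℝ E]
    {A : S → E} {γ : S → ℝ} (h : IsCircuitDep A γ) {u t : S} (ht : γ t ≠ 0) :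
    |γ u| ≤ (⨆ c : {c : Set S // IsCircuitSupport A c}, circuitRatio A c.val) * |γ t| := by
  refine (abs_le_depRatio_mul_abs γ ht).trans (mul_le_mul_of_nonneg_right ?_ (abs_nonneg _))
  have h1 : depRatio γ ≤ circuitRatio A {s | γ s ≠ 0} := by
    refine le_ciSup (f := fun δ : {δ : S → ℝ // δ ≠ 0 ∧ ∑ s, δ s • A s = 0 ∧
      {s | γ s ≠ 0} = {s | δ s ≠ 0}} => depRatio δ.val) ⟨depRatio γ, ?_⟩ ⟨γ, h.1, h.2.1, rfl⟩
    rintro _ ⟨⟨δ, hδ0, hδ, hsupp⟩, rfl⟩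
    obtain ⟨a, rfl⟩ := h.exists_eq_smul hδ hsupp
    refine depRatio_le hδ0 fun u t ht => ?_
    simp only [Pi.smul_apply, smul_eq_mul, abs_mul] at ht ⊢
    have := abs_le_depRatio_mul_abs γ (u := u) (right_ne_zero_of_mul ht)
    nlinarith [abs_nonneg a]
  exact h1.trans (le_ciSup (f := fun c : {c : Set S // IsCircuitSupport A c} =>
    circuitRatio A c.val) (Set.finite_range _).bddAbove ⟨_, h.isCircuitSupport⟩)

/-- By acyclicity, a dependence supported in `b` and nonzero at some top element of `b` is
negative at some top element of `b`. -/
theorem exists_neg_mem_nestTop {S E : Type*} [Fintype S] [AddCommGroup E] [Module ℝ E]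
    {A : S → E} {N : Set (Set S)} (hacyc : ∀ N' ⊆ N, IsFaceOf A (⋃₀ N')) {γ : S → ℝ}
    (hγ : ∑ s, γ s • A s = 0) {b : Set S} (hb : ∀ s, γ s ≠ 0 → s ∈ b) {u : S}
    (hu : u ∈ nestTop N b) (hγu : γ u ≠ 0) : ∃ t ∈ nestTop N b, γ t < 0 := by
  obtain ⟨f, hf0, hfpos⟩ := hacyc {c | c ∈ N ∧ ¬ b ⊆ c} fun c hc => hc.1
  have hsum : ∑ s, γ s * f (A s) = 0 := by
    have := congrArg f hγ
    simpa only [map_sum, map_smul, smul_eq_mul, map_zero] using this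
  by_contra hcon
  push Not at hcon
  have hpos : ∀ s ∈ nestTop N b, 0 < f (A s) := by
    intro s hs
    refine hfpos s ?_
    rintro ⟨c, ⟨hc, hbc⟩, hsc⟩
    exact hbc ((mem_nestTop.1 hs).2 c hc hsc)
  have hnonneg : ∀ s, 0 ≤ γ s * f (A s) := by
    intro s
    by_cases hs : γ s = 0
    · simp [hs]
    by_cases hst : s ∈ nestTop N b
    · exact mul_nonneg (hcon s hst) (hpos s hst).le
    · rw [mem_nestTop] at hst
      push Not at hst
      obtain ⟨c, hc, hsc, hbc⟩ := hst (hb s hs)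
      rw [hf0 s ⟨c, ⟨hc, hbc⟩, hsc⟩, mul_zero]
  have hzero := (Finset.sum_eq_zero_iff_of_nonneg fun s _ => hnonneg s).1 hsum u (Finset.mem_univ u)
  rcases mul_eq_zero.1 hzero with h | h
  · exact hγu h
  · exact (hpos u hu).ne' h

open scoped Classical in
/-- The entry at a top element of a block `b` of a circuit dependence conformal to `δ` is
controlled by its negative entries at top elements of larger blocks, provided `δ` is positive on
the top elements of `b`. -/
theorem IsCircuitDep.apply_le_sum_neg {S E : Type*} [Fintype S] [AddCommGroup E] [Module ℝ E]
    {A : S → E} {B N : Set (Set S)} (hB : IsOrientedBuilding A B) (hN : IsBoolNested B N)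
    (hacyc : ∀ N' ⊆ N, IsFaceOf A (⋃₀ N')) {δ γ : S → ℝ} (hγ : IsCircuitDep A γ)
    (hconf : SignConformal γ δ) {b : Set S} (hb : b ∈ B) {s : S} (hs : s ∈ nestTop N b)
    (hpos : ∀ t ∈ nestTop N b, 0 < δ t) :
    γ s ≤ (⨆ c : {c : Set S // IsCircuitSupport A c}, circuitRatio A c.val) *
      ∑ b' ∈ {b' ∈ (Set.toFinite B).toFinset | b ⊆ b' ∧ ∀ t ∈ nestTop N b', δ t < 0 → t ∉ b},
        ∑ t ∈ nestTop N b' with δ t < 0, -γ t := by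
  set r := ⨆ c : {c : Set S // IsCircuitSupport A c}, circuitRatio A c.val
  have hr : 0 ≤ r := Real.iSup_nonneg fun _ => circuitRatio_nonneg _ _
  have hneg : ∀ t, δ t < 0 → 0 ≤ -γ t := by
    intro t ht
    by_contra hcon
    have := (hconf t).1 (by linarith)
    linarith
  have hinner : ∀ b', 0 ≤ ∑ t ∈ nestTop N b' with δ t < 0, -γ t := fun b' =>
    Finset.sum_nonneg fun t ht => hneg t (Finset.mem_filter.1 ht).2
  rcases le_or_gt (γ s) 0 with hγs | hγs
  · exact hγs.trans (mul_nonneg hr (Finset.sum_nonneg fun b' _ => hinner b'))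
  have hst := mem_nestTop.1 hs
  have hb' : b ∪ {t | γ t ≠ 0} ∈ B :=
    hB.1.2.2 _ hb _ (hB.2 _ hγ.isCircuitSupport) ⟨s, hst.1, hγs.ne'⟩
  obtain ⟨u, hu, hγu⟩ : ∃ u ∈ nestTop N (b ∪ {t | γ t ≠ 0}), γ u ≠ 0 := by
    obtain ⟨u, hu⟩ := hN.nestTop_nonempty hB.1 hb'
    have hut := mem_nestTop.1 hu
    rcases hut.1 with hub | huc
    · exact ⟨s, mem_nestTop.2 ⟨Or.inl hst.1, fun c hc hsc => hut.2 c hc (hst.2 c hc hsc hub)⟩,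
        hγs.ne'⟩
    · exact ⟨u, hu, huc⟩
  obtain ⟨t, ht, hγt⟩ := exists_neg_mem_nestTop hacyc hγ.2.1 (fun s hs => Or.inr hs) hu hγu
  have h1 : γ s ≤ r * -γ t := by
    have := hγ.abs_le_mul_abs (u := s) hγt.ne
    rwa [abs_of_pos hγs, abs_of_neg hγt] at this
  refine h1.trans (mul_le_mul_of_nonneg_left ?_ hr)
  calc -γ t ≤ ∑ t ∈ nestTop N (b ∪ {t | γ t ≠ 0}) with δ t < 0, -γ t :=
        Finset.single_le_sum (f := fun t => -γ t)
          (fun t ht => hneg t (Finset.mem_filter.1 ht).2)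
          (Finset.mem_filter.2 ⟨ht, (hconf t).2 hγt⟩)
    _ ≤ _ := by
        refine Finset.single_le_sum
          (f := fun b' => ∑ t ∈ nestTop N b' with δ t < 0, -γ t) (fun b' _ => hinner b') ?_
        simp only [Finset.mem_filter, Set.Finite.mem_toFinset]
        refine ⟨hb', Set.subset_union_left, fun v hv hδv hvb => ?_⟩
        have hvt := mem_nestTop.1 hv
        exact hδv.not_gt (hpos v (mem_nestTop.2
          ⟨hvb, fun c hc hvc => Set.subset_union_left.trans (hvt.2 c hc hvc)⟩))

theorem mul_pow_mul_natCast_le_pow {R : ℝ} (hR : 2 ≤ R) {m n l : ℕ} (h : m + n ≤ l) :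
    R * R ^ m * n ≤ R ^ l := by
  rcases n with _ | n
  · simp only [Nat.cast_zero, mul_zero]
    positivity
  have h1 : ((n + 1 : ℕ) : ℝ) ≤ R ^ n := by
    calc ((n + 1 : ℕ) : ℝ) ≤ (2 : ℝ) ^ n := by exact_mod_cast n.lt_two_pow_self
      _ ≤ R ^ n := pow_le_pow_left₀ (by norm_num) hR n
  calc R * R ^ m * ((n + 1 : ℕ) : ℝ) ≤ R * R ^ m * R ^ n :=
        mul_le_mul_of_nonneg_left h1 (by positivity)
    _ = R ^ (m + (n + 1)) := by ring
    _ ≤ R ^ l := pow_le_pow_right₀ (by linarith) h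

theorem bigR_nonneg {S E : Type*} [Fintype S] [AddCommGroup E] [Module ℝ E]
    (A : S → E) (B : Set (Set S)) : 0 ≤ bigR A B :=
  mul_nonneg (Nat.cast_nonneg _) (Real.iSup_nonneg fun _ => circuitRatio_nonneg _ _)

theorem nestWeight_nonneg {S E : Type*} [Fintype S] [AddCommGroup E] [Module ℝ E]
    (A : S → E) (B : Set (Set S)) (b : Set S) : 0 ≤ nestWeight A B b := by
  unfold nestWeight
  split_ifs
  · exact le_rfl
  · exact pow_nonneg (bigR_nonneg A B) _

theorem one_le_iSup_circuitRatio {S E : Type*} [Fintype S] [AddCommGroup E] [Module ℝ E]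
    {A : S → E} {δ : S → ℝ} (hδ : ∑ s, δ s • A s = 0) (h0 : δ ≠ 0) :
    1 ≤ ⨆ c : {c : Set S // IsCircuitSupport A c}, circuitRatio A c.val := by
  by_contra hcon
  refine h0 ((AddSubmonoid.mem_bot (M := S → ℝ)).1
    ((AddSubmonoid.closure_le.2 ?_) (mem_closure_conformal_circuits A δ hδ)))
  rintro γ ⟨hγ, -⟩
  obtain ⟨s, hs⟩ := Function.ne_iff.1 hγ.1
  have := hγ.abs_le_mul_abs (u := s) hs
  exact absurd (le_of_mul_le_mul_right (by simpa using this) (abs_pos.2 hs)) hcon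

/-- The weighted positive part of `δ` selected by a block is at most the `|B|`-th part of the
total weighted negative part selected by all the blocks. -/
theorem ncard_mul_nestWeight_mul_le {S E : Type*} [Fintype S] [AddCommGroup E] [Module ℝ E]
    {A : S → E} {B N : Set (Set S)} (hB : IsOrientedBuilding A B) (hN : IsBoolNested B N)
    (hacyc : ∀ N' ⊆ N, IsFaceOf A (⋃₀ N')) {δ : S → ℝ} (hδ : ∑ s, δ s • A s = 0)
    {p : Set S → S} (hp : ∀ b ∈ B, p b ∈ nestTop N b ∧ ∀ s ∈ nestTop N b, δ (p b) ≤ δ s)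
    {b : Set S} (hb : b ∈ B) :
    B.ncard * (nestWeight A B b * max 0 (δ (p b))) ≤
      ∑ b' ∈ (Set.toFinite B).toFinset, nestWeight A B b' * max 0 (-δ (p b')) := by
  classical
  have hterm : ∀ b', 0 ≤ nestWeight A B b' * max 0 (-δ (p b')) := fun b' =>
    mul_nonneg (nestWeight_nonneg A B b') (le_max_left _ _)
  have hRHS := Finset.sum_nonneg fun b' (_ : b' ∈ (Set.toFinite B).toFinset) => hterm b'
  rcases le_or_gt (δ (p b)) 0 with hd | hd
  · rw [max_eq_left hd]
    simpa using hRHS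
  by_cases hcard : b.ncard = 1
  · rw [nestWeight, if_pos hcard]
    simpa using hRHS
  have hcard2 : 2 ≤ b.ncard := by
    have := (Set.ncard_pos (Set.toFinite b)).2 (hB.1.1 b hb)
    omega
  set W : Finset (Set S) := {b' ∈ (Set.toFinite B).toFinset |
    b ⊆ b' ∧ ∀ t ∈ nestTop N b', δ t < 0 → t ∉ b} with hW
  set r := ⨆ c : {c : Set S // IsCircuitSupport A c}, circuitRatio A c.val
  have hRr : bigR A B = B.ncard * r := rfl
  have hr1 : 1 ≤ r := one_le_iSup_circuitRatio hδ fun h => by simp [h] at hd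
  have hR2 : 2 ≤ bigR A B := by
    have hB2 : 1 < B.ncard := by
      rw [Set.one_lt_ncard]
      refine ⟨b, hb, {p b}, hB.1.2.1 _, fun h => hcard ?_⟩
      rw [h, Set.ncard_singleton]
    have : (2 : ℝ) ≤ B.ncard := by exact_mod_cast hB2
    rw [hRr]
    nlinarith
  have hmain : δ (p b) ≤ r * ∑ b' ∈ W, ∑ t ∈ nestTop N b' with δ t < 0, -δ t := by
    have hpos : ∀ t ∈ nestTop N b, 0 < δ t := fun t ht => hd.trans_le ((hp b hb).2 t ht)
    refine AddSubmonoid.closure_induction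
      (motive := fun γ _ => γ (p b) ≤ r * ∑ b' ∈ W, ∑ t ∈ nestTop N b' with δ t < 0, -γ t)
      ?_ ?_ ?_ (mem_closure_conformal_circuits A δ hδ)
    · rintro γ ⟨hγ, hconf⟩
      exact hγ.apply_le_sum_neg hB hN hacyc hconf hb (hp b hb).1 hpos
    · simp
    · intro x y _ _ hx hy
      simp only [Pi.add_apply, neg_add, Finset.sum_add_distrib, mul_add]
      exact add_le_add hx hy
  have hblock : ∀ b' ∈ W, bigR A B * bigR A B ^ b.ncard *
      ∑ t ∈ nestTop N b' with δ t < 0, -δ t ≤ nestWeight A B b' * max 0 (-δ (p b')) := by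
    intro b' hb'
    simp only [hW, Finset.mem_filter, Set.Finite.mem_toFinset] at hb'
    obtain ⟨hb'B, hsub, hnot⟩ := hb'
    set n := ((nestTop N b').filter fun t => δ t < 0).card with hn
    have h1 : ∑ t ∈ nestTop N b' with δ t < 0, -δ t ≤ n * max 0 (-δ (p b')) := by
      rw [← nsmul_eq_mul]
      refine Finset.sum_le_card_nsmul _ _ _ fun t ht => le_max_of_le_right ?_
      exact neg_le_neg ((hp b' hb'B).2 t (Finset.mem_filter.1 ht).1)
    have h2 : b.ncard + n ≤ b'.ncard := by
      rw [hn, ← Set.ncard_coe_finset, ← Set.ncard_union_eq]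
      · refine Set.ncard_le_ncard (Set.union_subset hsub fun t ht => ?_) (Set.toFinite _)
        exact (mem_nestTop.1 (Finset.mem_filter.1 ht).1).1
      · rw [Set.disjoint_left]
        intro t htb ht
        have := Finset.mem_filter.1 ht
        exact hnot t this.1 this.2 htb
    have hw : nestWeight A B b' = bigR A B ^ b'.ncard := if_neg (by omega)
    rw [hw]
    calc _ ≤ bigR A B * bigR A B ^ b.ncard * (n * max 0 (-δ (p b'))) :=
          mul_le_mul_of_nonneg_left h1 (by positivity)
      _ = bigR A B * bigR A B ^ b.ncard * n * max 0 (-δ (p b')) := by ring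
      _ ≤ _ := mul_le_mul_of_nonneg_right (mul_pow_mul_natCast_le_pow hR2 h2) (le_max_left _ _)
  have hw : nestWeight A B b = bigR A B ^ b.ncard := if_neg hcard
  rw [max_eq_right hd.le, hw]
  calc (B.ncard : ℝ) * (bigR A B ^ b.ncard * δ (p b))
      ≤ B.ncard * (bigR A B ^ b.ncard *
          (r * ∑ b' ∈ W, ∑ t ∈ nestTop N b' with δ t < 0, -δ t)) := by gcongr
    _ = ∑ b' ∈ W, bigR A B * bigR A B ^ b.ncard * ∑ t ∈ nestTop N b' with δ t < 0, -δ t := by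
        rw [← Finset.mul_sum]
        nth_rw 2 [hRr]
        ring
    _ ≤ ∑ b' ∈ W, nestWeight A B b' * max 0 (-δ (p b')) := Finset.sum_le_sum hblock
    _ ≤ _ := Finset.sum_le_sum_of_subset_of_nonneg (Finset.filter_subset _ _)
        fun b' _ _ => hterm b'

theorem sum_nestWeight_mul_nonpos {S E : Type*} [Fintype S] [AddCommGroup E] [Module ℝ E]
    {A : S → E} {B N : Set (Set S)} (hB : IsOrientedBuilding A B) (hN : IsBoolNested B N)
    (hacyc : ∀ N' ⊆ N, IsFaceOf A (⋃₀ N')) {δ : S → ℝ} (hδ : ∑ s, δ s • A s = 0)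
    {p : Set S → S} (hp : ∀ b ∈ B, p b ∈ nestTop N b ∧ ∀ s ∈ nestTop N b, δ (p b) ≤ δ s) :
    ∑ b ∈ (Set.toFinite B).toFinset, nestWeight A B b * δ (p b) ≤ 0 := by
  set T := (Set.toFinite B).toFinset with hT
  have hcard : (B.ncard : ℝ) = T.card := by rw [Set.ncard_eq_toFinset_card B (Set.toFinite B)]
  set Q := ∑ b' ∈ T, nestWeight A B b' * max 0 (-δ (p b')) with hQ
  have hsplit : ∑ b ∈ T, nestWeight A B b * δ (p b) =
      ∑ b ∈ T, nestWeight A B b * max 0 (δ (p b)) - Q := by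
    rw [hQ, ← Finset.sum_sub_distrib]
    refine Finset.sum_congr rfl fun b _ => ?_
    rw [← mul_sub]
    congr 1
    rcases le_total (δ (p b)) 0 with h | h
    · rw [max_eq_left h, max_eq_right (by linarith)]; ring
    · rw [max_eq_right h, max_eq_left (by linarith)]; ring
  rcases T.eq_empty_or_nonempty with h0 | hne
  · simp [h0]
  have hpos : (0 : ℝ) < T.card := by exact_mod_cast hne.card_pos
  have hle : (T.card : ℝ) * ∑ b ∈ T, nestWeight A B b * max 0 (δ (p b)) ≤ T.card * Q := by
    rw [Finset.mul_sum, ← nsmul_eq_mul T.card Q]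
    refine Finset.sum_le_card_nsmul _ _ _ fun b hb => ?_
    rw [← hcard]
    exact ncard_mul_nestWeight_mul_le hB hN hacyc hδ hp (by simpa [hT] using hb)
  have := le_of_mul_le_mul_left hle hpos
  linarith

open scoped Classical in
theorem nestVertex_apply {S E : Type*} [Fintype S] [AddCommGroup E] [Module ℝ E]
    (A : S → E) (B M : Set (Set S)) (s : S) :
    nestVertex A B M s =
      ∑ b ∈ (Set.toFinite B).toFinset, if s ∈ nestTop M b then nestWeight A B b else 0 := by
  rw [nestVertex, finsum_mem_eq_finite_toFinset_sum _ (Set.toFinite _), ← Finset.sum_filter]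
  refine Finset.sum_congr ?_ fun _ _ => rfl
  ext b
  simp only [Set.Finite.mem_toFinset, Finset.mem_filter, mem_nestTop]
  exact Iff.rfl

theorem sum_mul_nestVertex {S E : Type*} [Fintype S] [AddCommGroup E] [Module ℝ E]
    (A : S → E) (B M : Set (Set S)) (δ : S → ℝ) {p : Set S → S}
    (hp : ∀ b ∈ B, nestTop M b = {p b}) :
    ∑ s, δ s * nestVertex A B M s =
      ∑ b ∈ (Set.toFinite B).toFinset, nestWeight A B b * δ (p b) := by
  classical
  simp only [nestVertex_apply, Finset.mul_sum]
  rw [Finset.sum_comm]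
  refine Finset.sum_congr rfl fun b hb => ?_
  rw [hp b (by simpa using hb)]
  simp [mul_comm]

/-- A compact convex set that is not on the positive side of any linear dependence of `A` meets
the evaluation space. -/
theorem inter_evalSpace_nonempty {S E : Type*} [Fintype S] [AddCommGroup E] [Module ℝ E]
    (A : S → E) {Q : Set (S → ℝ)} (hconv : Convex ℝ Q) (hcomp : IsCompact Q)
    (hQ : ∀ δ : S → ℝ, ∑ s, δ s • A s = 0 → ∃ x ∈ Q, ∑ s, δ s * x s ≤ 0) :
    (Q ∩ evalSpace A).Nonempty := by
  classical
  let V : Submodule ℝ (S → ℝ) := LinearMap.range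
    (LinearMap.pi fun s => LinearMap.applyₗ (A s) : (E →ₗ[ℝ] ℝ) →ₗ[ℝ] (S → ℝ))
  have hV : evalSpace A = (V : Set (S → ℝ)) := by
    ext x
    constructor
    · rintro ⟨f, hf⟩
      exact ⟨f, funext fun s => (hf s).symm⟩
    · rintro ⟨f, rfl⟩
      exact ⟨f, fun s => rfl⟩
  by_contra hcon
  rw [Set.not_nonempty_iff_eq_empty, ← Set.disjoint_iff_inter_eq_empty, hV] at hcon
  obtain ⟨f, u, v, hfQ, huv, hfV⟩ := geometric_hahn_banach_compact_closed hconv hcomp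
    V.convex V.closed_of_finiteDimensional hcon
  have hv0 : v < 0 := by simpa using hfV 0 V.zero_mem
  have hf0 : ∀ x ∈ V, f x = 0 := by
    intro x hx
    by_contra hne
    have := hfV ((v / f x) • x) (V.smul_mem _ hx)
    rw [map_smul, smul_eq_mul, div_mul_cancel₀ _ hne] at this
    exact lt_irrefl _ this
  have hfsum : ∀ x : S → ℝ, f x = ∑ s, f (Pi.single s 1) * x s := by
    intro x
    conv_lhs => rw [pi_eq_sum_univ' x, map_sum]
    refine Finset.sum_congr rfl fun s _ => ?_
    rw [map_smul, smul_eq_mul, mul_comm]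
  obtain ⟨x, hxQ, hx⟩ := hQ (fun s => -f (Pi.single s 1)) (by
    refine (Module.forall_dual_apply_eq_zero_iff ℝ _).1 fun g => ?_
    have := hf0 (fun s => g (A s)) ⟨g, rfl⟩
    rw [hfsum] at this
    simp only [map_sum, map_smul, smul_eq_mul, neg_mul, Finset.sum_neg_distrib, this, neg_zero])
  have h1 := hfQ x hxQ
  rw [hfsum] at h1
  simp only [neg_mul, Finset.sum_neg_distrib] at hx
  linarith

/-- **Acyclic nested sets survive the section** (Lemma `acyclonestohedron2`). Let `A` be a
finite linearly dependent family of vectors of a finite-dimensional real inner product space,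
`B` an oriented building set for `A` with the weights `ρ_b = R^{|b|}` (`ρ_b = 0` for
singletons, `R = |B| · max_c r_c`), and `N` a nested set on `B` that is acyclic for `A`.
Then the face of the nestohedron corresponding to `N` — the convex hull of the vertices
`v_M(ρ)` over the maximal nested sets `M ⊇ N` — meets the evaluation space of `A`. -/
theorem acyclic_face_meets_evaluation_space {S E : Type*} [NormedAddCommGroup E]
    [InnerProductSpace ℝ E] [FiniteDimensional ℝ E] [Fintype S]
    (A : S → E) (hdep : ¬ LinearIndependent ℝ A)
    (B : Set (Set S)) (hB : IsOrientedBuilding A B)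
    (N : Set (Set S)) (hN : IsBoolNested B N)
    (hacyc : ∀ N' ⊆ N, IsFaceOf A (⋃₀ N')) :
    (convexHull ℝ {x : S → ℝ | ∃ M : Set (Set S), IsMaxNested B M ∧ N ⊆ M ∧
        x = nestVertex A B M} ∩
      evalSpace A).Nonempty := by
  have : Nonempty S := by
    by_contra hS
    rw [not_nonempty_iff] at hS
    exact hdep linearIndependent_empty_type
  refine inter_evalSpace_nonempty A (convex_convexHull ℝ _) ?_ fun δ hδ => ?_
  · refine Set.Finite.isCompact_convexHull ℝ (Set.Finite.subset
      (Set.finite_range fun M : Set (Set S) => nestVertex A B M) ?_)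
    rintro x ⟨M, -, -, rfl⟩
    exact ⟨M, rfl⟩
  · obtain ⟨M, hM, hNM, p, hp⟩ := hN.exists_isMaxNested_argmin hB.1 δ
    refine ⟨nestVertex A B M, subset_convexHull ℝ _ ⟨M, hM, hNM, rfl⟩, ?_⟩
    rw [sum_mul_nestVertex A B M δ fun b hb => (hp b hb).1]
    exact sum_nestWeight_mul_nonpos hB hN hacyc hδ fun b hb => (hp b hb).2
end
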